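/- Let A be a nonzero C*-algebra with no K₁-obstructions, and let X be a compact metric space of covering dimension one. Then the real rank of C(X,A) equals 1. -/

import Mathlib

noncomputable section

set_option maxHeartbeats 1000000

def StableRankOne (A : Type*) [NonUnitalCStarAlgebra A] : Prop :=
  Dense {x : Unitization ℂ A | IsUnit x}

def K1Trivial (B : Type*) [NonUnitalCStarAlgebra B] : Prop :=
  ∀ n : ℕ, 0 < n → ∀ u : unitary (Matrix (Fin n) (Fin n) (Unitization ℂ B)),
    ∃ (k : ℕ) (h : Matrix.fromBlocks u.1 0 0
        (1 : Matrix (Fin k) (Fin k) (Unitization ℂ B)) ∈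
        unitary (Matrix (Fin n ⊕ Fin k) (Fin n ⊕ Fin k) (Unitization ℂ B))),
      Joined (1 : unitary (Matrix (Fin n ⊕ Fin k) (Fin n ⊕ Fin k) (Unitization ℂ B)))
        ⟨Matrix.fromBlocks u.1 0 0 1, h⟩

def NoK1Obstructions (A : Type*) [NonUnitalCStarAlgebra A] : Prop :=
  StableRankOne A ∧
    ∀ (B : NonUnitalStarSubalgebra ℂ A) [IsClosed (B : Set A)],
      (∀ b ∈ B, ∀ a : A, ∀ b' ∈ B, b * a * b' ∈ B) → K1Trivial B
/-- Covering dimension at most `n`: every finite open cover has a finite open refinement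
covering `X` in which each point lies in at most `n + 1` members. -/
def CoveringDimLE (X : Type*) [TopologicalSpace X] (n : ℕ) : Prop :=
  ∀ 𝒰 : Finset (Set X), (∀ U ∈ 𝒰, IsOpen U) → ⋃₀ (𝒰 : Set (Set X)) = Set.univ →
    ∃ 𝒱 : Finset (Set X), (∀ V ∈ 𝒱, IsOpen V) ∧ ⋃₀ (𝒱 : Set (Set X)) = Set.univ ∧
      (∀ V ∈ 𝒱, ∃ U ∈ 𝒰, V ⊆ U) ∧
      ∀ x : X, Set.ncard {V : Set X | V ∈ 𝒱 ∧ x ∈ V} ≤ n + 1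

/-- Covering dimension exactly `n`. -/
def CoveringDimEq (X : Type*) [TopologicalSpace X] (n : ℕ) : Prop :=
  CoveringDimLE X n ∧ ∀ m : ℕ, CoveringDimLE X m → n ≤ m

/-- Real rank at most `n`: `(n+1)`-tuples of self-adjoint elements of the minimal unitization
can be approximated by self-adjoint tuples whose sum of squares is invertible. -/
def RealRankLE (A : Type*) [NonUnitalCStarAlgebra A] (n : ℕ) : Prop :=
  ∀ a : Fin (n + 1) → Unitization ℂ A, (∀ k, IsSelfAdjoint (a k)) → ∀ ε : ℝ, 0 < ε →
    ∃ x : Fin (n + 1) → Unitization ℂ A, (∀ k, IsSelfAdjoint (x k)) ∧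
      IsUnit (∑ k, x k ^ 2) ∧ ∀ k, ‖x k - a k‖ < ε

section

open Topology Matrix Filter

theorem continuousAt_ringInverse_of_isOpenEmbedding {S : Type*} [Ring S] [TopologicalSpace S]
    (h : IsOpenEmbedding (Units.val : Sˣ → S)) (u : Sˣ) :
    ContinuousAt Ring.inverse (u : S) := by
  rw [← h.continuousAt_iff]
  have : Ring.inverse ∘ (Units.val : Sˣ → S) = fun v => ((v⁻¹ : Sˣ) : S) := by
    funext v; simp
  rw [this]
  exact Units.continuous_coe_inv.continuousAt

theorem Matrix.isOpenEmbedding_unitsVal {ι R : Type*} [Fintype ι] [DecidableEq ι]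
    [NormedRing R] [CompleteSpace R] :
    IsOpenEmbedding (Units.val : (Matrix ι ι R)ˣ → Matrix ι ι R) := by
  let i : NormedRing (Matrix ι ι R) := Matrix.linftyOpNormedRing
  have : @CompleteSpace (Matrix ι ι R) i.toUniformSpace :=
    inferInstanceAs (CompleteSpace (ι → ι → R))
  exact @Units.isOpenEmbedding_val (Matrix ι ι R) i _

/-- `D` is a locally trivial homomorphism on invertible matrices which agrees with `Q`
along Sylvester's identity `det (1 + y x) = det (1 + x y)`. -/
structure IsSylvesterExtension {ι κ R G : Type*} [Fintype ι] [DecidableEq ι] [Fintype κ]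
    [DecidableEq κ] [NormedRing R] [CommGroup G] (Q : (Matrix κ κ R)ˣ →* G)
    (D : (Matrix ι ι R)ˣ →* G) : Prop where
  eventually_eq_one : ∀ᶠ u in 𝓝 (1 : (Matrix ι ι R)ˣ), D u = 1
  sylvester : ∀ (y : Matrix ι κ R) (x : Matrix κ ι R) (U : (Matrix ι ι R)ˣ)
    (u : (Matrix κ κ R)ˣ), (U : Matrix ι ι R) = 1 + y * x → (u : Matrix κ κ R) = 1 + x * y →
    D U = Q u

namespace IsSylvesterExtension

section Sum

variable {ι κ R G : Type*} [Fintype ι] [DecidableEq ι] [Fintype κ] [DecidableEq κ]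
  [NormedRing R] [CommGroup G] {Q : (Matrix κ κ R)ˣ →* G} {D : (Matrix ι ι R)ˣ →* G}

/-- `T` has an upper-diagonal-lower block factorization whose diagonal has determinant `g`. -/
def BlockDet (Q : (Matrix κ κ R)ˣ →* G) (D : (Matrix ι ι R)ˣ →* G)
    (T : Matrix (ι ⊕ κ) (ι ⊕ κ) R) (g : G) : Prop :=
  ∃ (s : (Matrix ι ι R)ˣ) (d : (Matrix κ κ R)ˣ) (y : Matrix ι κ R) (x : Matrix κ ι R),
    T = fromBlocks ((s : Matrix ι ι R) + y * (d : Matrix κ κ R) * x) (y * (d : Matrix κ κ R))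
      ((d : Matrix κ κ R) * x) (d : Matrix κ κ R) ∧ g = D s * Q d

theorem BlockDet.unique {T : Matrix (ι ⊕ κ) (ι ⊕ κ) R} {g h : G}
    (hg : BlockDet Q D T g) (hh : BlockDet Q D T h) : g = h := by
  obtain ⟨s, d, y, x, rfl, rfl⟩ := hg
  obtain ⟨s', d', y', x', h, rfl⟩ := hh
  rw [fromBlocks_inj] at h
  obtain ⟨h1, h2, h3, h4⟩ := h
  have hd : d = d' := Units.ext h4
  subst hd
  have hy : y = y' := by
    have := congrArg (· * ((d⁻¹ : (Matrix κ κ R)ˣ) : Matrix κ κ R)) h2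
    simpa [Matrix.mul_assoc, ← Units.val_mul] using this
  have hx : x = x' := by
    have := congrArg (((d⁻¹ : (Matrix κ κ R)ˣ) : Matrix κ κ R) * ·) h3
    simpa [← Matrix.mul_assoc, ← Units.val_mul] using this
  subst hy hx
  have hs : s = s' := Units.ext (by simpa using h1)
  rw [hs]

theorem BlockDet.of_isUnit {T : Matrix (ι ⊕ κ) (ι ⊕ κ) R} (hT : IsUnit T)
    (hd : IsUnit T.toBlocks₂₂) : ∃ g, BlockDet Q D T g := by
  obtain ⟨d, hd⟩ := hd
  set e : Matrix κ κ R := ((d⁻¹ : (Matrix κ κ R)ˣ) : Matrix κ κ R) with he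
  have hde : (d : Matrix κ κ R) * e = 1 := by simp [he, ← Units.val_mul]
  have hed : e * (d : Matrix κ κ R) = 1 := by simp [he, ← Units.val_mul]
  set a := T.toBlocks₁₁
  set b := T.toBlocks₁₂
  set c := T.toBlocks₂₁
  have hTb : T = fromBlocks a b c d := by rw [hd]; exact (fromBlocks_toBlocks T).symm
  obtain ⟨V, hV⟩ := hT
  set s := a - b * e * c
  -- the diagonal part of the factorization is invertible
  set P : Matrix (ι ⊕ κ) (ι ⊕ κ) R := ((V⁻¹ : (Matrix (ι ⊕ κ) (ι ⊕ κ) R)ˣ) :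
    Matrix (ι ⊕ κ) (ι ⊕ κ) R)
  have hVP : T * P = 1 := by rw [← hV]; simp [P, ← Units.val_mul]
  have hPV : P * T = 1 := by rw [← hV]; simp [P, ← Units.val_mul]
  have key1 : fromBlocks 1 (-(b * e)) 0 1 * T * fromBlocks 1 0 (-(e * c)) 1
      = fromBlocks s 0 0 (d : Matrix κ κ R) := by
    rw [hTb]
    simp only [fromBlocks_multiply]
    congr 1 <;>
    simp [s, Matrix.mul_assoc, hed, hde, Matrix.mul_sub, Matrix.sub_mul, sub_eq_add_neg,
      Matrix.add_mul, Matrix.mul_add] <;>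
    simp [← Matrix.mul_assoc, hed, hde]
  have hU1 : (fromBlocks 1 (-(b * e)) 0 1 : Matrix (ι ⊕ κ) (ι ⊕ κ) R) *
      fromBlocks 1 (b * e) 0 1 = 1 := by
    simp [fromBlocks_multiply]
  have hU2 : (fromBlocks 1 (b * e) 0 1 : Matrix (ι ⊕ κ) (ι ⊕ κ) R) *
      fromBlocks 1 (-(b * e)) 0 1 = 1 := by
    simp [fromBlocks_multiply]
  have hL1 : (fromBlocks 1 0 (-(e * c)) 1 : Matrix (ι ⊕ κ) (ι ⊕ κ) R) *
      fromBlocks 1 0 (e * c) 1 = 1 := by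
    simp [fromBlocks_multiply]
  have hL2 : (fromBlocks 1 0 (e * c) 1 : Matrix (ι ⊕ κ) (ι ⊕ κ) R) *
      fromBlocks 1 0 (-(e * c)) 1 = 1 := by
    simp [fromBlocks_multiply]
  set Z := fromBlocks 1 0 (e * c) 1 * P * fromBlocks 1 (b * e) 0 1
  have hZ1 : fromBlocks s 0 0 (d : Matrix κ κ R) * Z = 1 := by
    rw [← key1]
    calc _ = fromBlocks 1 (-(b * e)) 0 1 * (T * ((fromBlocks 1 0 (-(e * c)) 1 *
          fromBlocks 1 0 (e * c) 1) * P)) * fromBlocks 1 (b * e) 0 1 := by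
          simp only [Z, Matrix.mul_assoc]
      _ = 1 := by rw [hL1, one_mul, hVP, mul_one, hU1]
  have hZ2 : Z * fromBlocks s 0 0 (d : Matrix κ κ R) = 1 := by
    rw [← key1]
    calc _ = fromBlocks 1 0 (e * c) 1 * (P * ((fromBlocks 1 (b * e) 0 1 *
          fromBlocks 1 (-(b * e)) 0 1) * T)) * fromBlocks 1 0 (-(e * c)) 1 := by
          simp only [Z, Matrix.mul_assoc]
      _ = 1 := by rw [hU2, one_mul, hPV, mul_one, hL2]
  have hs1 : s * Z.toBlocks₁₁ = 1 := by
    rw [← fromBlocks_toBlocks Z, fromBlocks_multiply, ← fromBlocks_one, fromBlocks_inj] at hZ1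
    simpa using hZ1.1
  have hs2 : Z.toBlocks₁₁ * s = 1 := by
    rw [← fromBlocks_toBlocks Z, fromBlocks_multiply, ← fromBlocks_one, fromBlocks_inj] at hZ2
    simpa using hZ2.1
  refine ⟨_, ⟨s, Z.toBlocks₁₁, hs1, hs2⟩, d, b * e, e * c, ?_, rfl⟩
  rw [hTb]
  congr 1
  · simp [s, Matrix.mul_assoc, hed]
  · simp [Matrix.mul_assoc, hed]
  · simp [← Matrix.mul_assoc, hde]

theorem BlockDet.mul (hD : IsSylvesterExtension Q D) {T S : Matrix (ι ⊕ κ) (ι ⊕ κ) R} {g h : G}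
    (hT : BlockDet Q D T g) (hS : BlockDet Q D S h) (hTS : IsUnit (T * S).toBlocks₂₂) :
    BlockDet Q D (T * S) (g * h) := by
  obtain ⟨s, d, y, x, rfl, rfl⟩ := hT
  obtain ⟨s', d', y', x', rfl, rfl⟩ := hS
  have he : IsUnit (1 + x * y') := by
    rw [fromBlocks_multiply, toBlocks_fromBlocks₂₂] at hTS
    have : (d : Matrix κ κ R) * x * (y' * (d' : Matrix κ κ R)) + (d : Matrix κ κ R) * (d' : Matrix κ κ R) = (d : Matrix κ κ R) * (1 + x * y') * (d' : Matrix κ κ R) := by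
      simp [Matrix.mul_add, Matrix.add_mul, Matrix.mul_assoc, add_comm]
    rw [this] at hTS
    simpa using hTS
  obtain ⟨e, he⟩ := he
  set e' : Matrix κ κ R := ((e⁻¹ : (Matrix κ κ R)ˣ) : Matrix κ κ R) with he'
  have hee' : (1 + x * y') * e' = 1 := by rw [← he]; simp [he', ← Units.val_mul]
  have he'e : e' * (1 + x * y') = 1 := by rw [← he]; simp [he', ← Units.val_mul]
  have hf1 : (1 + y' * x) * (1 - y' * e' * x) = 1 := by
    calc (1 + y' * x) * (1 - y' * e' * x) = 1 + y' * x - y' * ((1 + x * y') * e') * x := by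
          simp only [Matrix.mul_add, Matrix.add_mul, Matrix.mul_sub, Matrix.sub_mul,
            Matrix.mul_assoc, Matrix.mul_one, Matrix.one_mul]
      _ = 1 := by rw [hee']; simp
  have hf2 : (1 - y' * e' * x) * (1 + y' * x) = 1 := by
    calc (1 - y' * e' * x) * (1 + y' * x) = 1 + y' * x - y' * (e' * (1 + x * y')) * x := by
          simp only [Matrix.mul_add, Matrix.add_mul, Matrix.mul_sub, Matrix.sub_mul,
            Matrix.mul_assoc, Matrix.mul_one, Matrix.one_mul]
          abel
      _ = 1 := by rw [he'e]; simp
  set F : (Matrix ι ι R)ˣ := ⟨1 + y' * x, 1 - y' * e' * x, hf1, hf2⟩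
  have hF : D F = Q e := hD.sylvester y' x F e rfl he
  set f := F⁻¹
  have hDf : D f = (Q e)⁻¹ := by rw [map_inv, hF]
  have hfv : (f : Matrix ι ι R) = 1 - y' * e' * x := rfl
  set dd : Matrix κ κ R := ((d⁻¹ : (Matrix κ κ R)ˣ) : Matrix κ κ R)
  set dd' : Matrix κ κ R := ((d'⁻¹ : (Matrix κ κ R)ˣ) : Matrix κ κ R)
  have hdd : dd * (d : Matrix κ κ R) = 1 := by simp [dd, ← Units.val_mul]
  have hdd' : (d' : Matrix κ κ R) * dd' = 1 := by simp [dd', ← Units.val_mul]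
  refine ⟨s * f * s', d * e * d', y + (s : Matrix ι ι R) * y' * e' * dd,
    x' + dd' * e' * x * (s' : Matrix ι ι R), ?_, ?_⟩
  · have c1 : (y + (s : Matrix ι ι R) * y' * e' * dd) * ((d * e * d' : (Matrix κ κ R)ˣ) : Matrix κ κ R)
        = y * (d : Matrix κ κ R) * (1 + x * y') * (d' : Matrix κ κ R) + (s : Matrix ι ι R) * y' * (d' : Matrix κ κ R) := by
      calc _ = y * (d : Matrix κ κ R) * (e : Matrix κ κ R) * (d' : Matrix κ κ R) + (s : Matrix ι ι R) * y' * (e' * ((dd * (d : Matrix κ κ R)) * (e : Matrix κ κ R))) * (d' : Matrix κ κ R) := by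
            simp only [Units.val_mul, Matrix.add_mul, Matrix.mul_assoc]
        _ = _ := by rw [hdd, he, one_mul, he'e]; simp
    have c2 : ((d * e * d' : (Matrix κ κ R)ˣ) : Matrix κ κ R) * (x' + dd' * e' * x * (s' : Matrix ι ι R))
        = (d : Matrix κ κ R) * (1 + x * y') * (d' : Matrix κ κ R) * x' + (d : Matrix κ κ R) * x * (s' : Matrix ι ι R) := by
      calc _ = (d : Matrix κ κ R) * (e : Matrix κ κ R) * (d' : Matrix κ κ R) * x' + (d : Matrix κ κ R) * ((e : Matrix κ κ R) * (((d' : Matrix κ κ R) * dd') * e')) * x * (s' : Matrix ι ι R) := by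
            simp only [Units.val_mul, Matrix.mul_add, Matrix.mul_assoc]
        _ = _ := by rw [hdd', he, one_mul, hee']; simp
    rw [c1, c2, fromBlocks_multiply]
    congr 1
    · have c3 : (s : Matrix ι ι R) * y' * (d' : Matrix κ κ R) * (dd' * e' * x * (s' : Matrix ι ι R)) = (s : Matrix ι ι R) * (y' * e' * x) * (s' : Matrix ι ι R) := by
        calc _ = (s : Matrix ι ι R) * y' * ((d' : Matrix κ κ R) * dd') * e' * x * (s' : Matrix ι ι R) := by simp only [Matrix.mul_assoc]
          _ = _ := by rw [hdd']; simp [Matrix.mul_assoc]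
      have c4 : y * (d : Matrix κ κ R) * (1 + x * y') * (d' : Matrix κ κ R) * (dd' * e' * x * (s' : Matrix ι ι R)) = y * (d : Matrix κ κ R) * x * (s' : Matrix ι ι R) := by
        calc _ = y * (d : Matrix κ κ R) * ((1 + x * y') * (((d' : Matrix κ κ R) * dd') * e')) * x * (s' : Matrix ι ι R) := by
              simp only [Matrix.mul_assoc]
          _ = _ := by rw [hdd', one_mul, hee']; simp [Matrix.mul_assoc]
      rw [Matrix.mul_add (_ + _) x', Matrix.add_mul _ _ (dd' * e' * x * (s' : Matrix ι ι R)), c4, c3]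
      simp only [Units.val_mul, hfv, Matrix.mul_add, Matrix.add_mul, Matrix.mul_sub,
        Matrix.sub_mul, Matrix.mul_assoc, Matrix.mul_one]
      abel
    · simp only [Matrix.mul_add, Matrix.add_mul, Matrix.mul_assoc, Matrix.mul_one]
      abel
    · simp only [Matrix.mul_add, Matrix.add_mul, Matrix.mul_assoc, Matrix.mul_one]
      abel
    · simp only [Units.val_mul, he, Matrix.mul_add, Matrix.add_mul, Matrix.mul_assoc,
        Matrix.mul_one]
      abel
  · simp only [map_mul, hDf]
    calc D s * Q d * (D s' * Q d') = D s * D s' * (Q d * Q d') := by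
          rw [mul_mul_mul_comm]
      _ = D s * D s' * (Q d * Q d') * ((Q e)⁻¹ * Q e) := by simp
      _ = _ := by ac_rfl

end Sum

end IsSylvesterExtension

namespace IsSylvesterExtension

theorem eventually_exists_unit {ι R G : Type*} [Fintype ι] [DecidableEq ι]
    [NormedRing R] [CompleteSpace R] [Group G] {D : (Matrix ι ι R)ˣ →* G}
    (hD : ∀ᶠ u in 𝓝 (1 : (Matrix ι ι R)ˣ), D u = 1) (U : (Matrix ι ι R)ˣ) :
    ∀ᶠ m in 𝓝 (U : Matrix ι ι R), ∃ V : (Matrix ι ι R)ˣ, (V : Matrix ι ι R) = m ∧ D V = D U := by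
  have h1 : ∀ᶠ V in 𝓝 U, D V = D U := by
    have hc : Tendsto (fun V : (Matrix ι ι R)ˣ => U⁻¹ * V) (𝓝 U) (𝓝 1) := by
      have : Continuous (fun V : (Matrix ι ι R)ˣ => U⁻¹ * V) := continuous_const.mul continuous_id
      simpa using this.tendsto U
    filter_upwards [hc.eventually hD] with V hV
    rw [map_mul, map_inv, inv_mul_eq_one] at hV
    exact hV.symm
  have h2 := Matrix.isOpenEmbedding_unitsVal.isOpenMap.image_mem_nhds h1
  filter_upwards [h2] with m hm
  obtain ⟨V, hV, rfl⟩ := hm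
  exact ⟨V, rfl, hV⟩

section Sum

variable {ι κ R G : Type*} [Fintype ι] [DecidableEq ι] [Fintype κ] [DecidableEq κ]
  [NormedRing R] [CompleteSpace R] [CommGroup G] {Q : (Matrix κ κ R)ˣ →* G}
  {D : (Matrix ι ι R)ˣ →* G}

theorem BlockDet.isUnit_toBlocks₂₂ {T : Matrix (ι ⊕ κ) (ι ⊕ κ) R} {g : G}
    (h : BlockDet Q D T g) : IsUnit T.toBlocks₂₂ := by
  obtain ⟨s, d, y, x, rfl, -⟩ := h
  exact d.isUnit

theorem eventually_blockDet_one (hQ : ∀ᶠ u in 𝓝 (1 : (Matrix κ κ R)ˣ), Q u = 1)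
    (hD : IsSylvesterExtension Q D) :
    ∀ᶠ S : (Matrix (ι ⊕ κ) (ι ⊕ κ) R)ˣ in 𝓝 1,
      BlockDet Q D (S : Matrix (ι ⊕ κ) (ι ⊕ κ) R) 1 := by
  let f : Matrix (ι ⊕ κ) (ι ⊕ κ) R → Matrix ι ι R := fun T =>
    T.toBlocks₁₁ - T.toBlocks₁₂ * Ring.inverse T.toBlocks₂₂ * T.toBlocks₂₁
  have h11 : Continuous (toBlocks₁₁ : Matrix (ι ⊕ κ) (ι ⊕ κ) R → _) :=
    continuous_id.matrix_submatrix Sum.inl Sum.inl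
  have h12 : Continuous (toBlocks₁₂ : Matrix (ι ⊕ κ) (ι ⊕ κ) R → _) :=
    continuous_id.matrix_submatrix Sum.inl Sum.inr
  have h21 : Continuous (toBlocks₂₁ : Matrix (ι ⊕ κ) (ι ⊕ κ) R → _) :=
    continuous_id.matrix_submatrix Sum.inr Sum.inl
  have h22 : Continuous (toBlocks₂₂ : Matrix (ι ⊕ κ) (ι ⊕ κ) R → _) :=
    continuous_id.matrix_submatrix Sum.inr Sum.inr
  have e22 : (1 : Matrix (ι ⊕ κ) (ι ⊕ κ) R).toBlocks₂₂ = ((1 : (Matrix κ κ R)ˣ) : Matrix κ κ R) := by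
    rw [← fromBlocks_one, toBlocks_fromBlocks₂₂]; rfl
  have hf : ContinuousAt f 1 := by
    have hi : ContinuousAt (fun T : Matrix (ι ⊕ κ) (ι ⊕ κ) R => Ring.inverse T.toBlocks₂₂) 1 := by
      refine ContinuousAt.comp (f := toBlocks₂₂) (g := Ring.inverse) ?_ h22.continuousAt
      rw [e22]
      exact continuousAt_ringInverse_of_isOpenEmbedding Matrix.isOpenEmbedding_unitsVal 1
    have hmul1 : Continuous (fun p : Matrix ι κ R × Matrix κ κ R => p.1 * p.2) :=
      continuous_fst.matrix_mul continuous_snd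
    have hmul2 : Continuous (fun p : Matrix ι κ R × Matrix κ ι R => p.1 * p.2) :=
      continuous_fst.matrix_mul continuous_snd
    have h1 := hmul1.continuousAt.comp₂ (h12.continuousAt (x := 1)) hi
    exact h11.continuousAt.sub (hmul2.continuousAt.comp₂ h1 (h21.continuousAt (x := 1)))
  have hf1 : f 1 = ((1 : (Matrix ι ι R)ˣ) : Matrix ι ι R) := by
    have e11 : (1 : Matrix (ι ⊕ κ) (ι ⊕ κ) R).toBlocks₁₁ = 1 := by
      rw [← fromBlocks_one, toBlocks_fromBlocks₁₁]
    have e12 : (1 : Matrix (ι ⊕ κ) (ι ⊕ κ) R).toBlocks₁₂ = 0 := by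
      rw [← fromBlocks_one, toBlocks_fromBlocks₁₂]
    simp [f, e11, e12]
  have A1 : ∀ᶠ T in 𝓝 (1 : Matrix (ι ⊕ κ) (ι ⊕ κ) R), ∃ V : (Matrix ι ι R)ˣ,
      (V : Matrix ι ι R) = f T ∧ D V = D 1 :=
    hf.eventually (by rw [hf1]; exact eventually_exists_unit hD.eventually_eq_one 1)
  have A2 : ∀ᶠ T in 𝓝 (1 : Matrix (ι ⊕ κ) (ι ⊕ κ) R), ∃ V : (Matrix κ κ R)ˣ,
      (V : Matrix κ κ R) = T.toBlocks₂₂ ∧ Q V = Q 1 :=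
    h22.continuousAt.eventually (by rw [e22]; exact eventually_exists_unit hQ 1)
  have A : ∀ᶠ T in 𝓝 (1 : Matrix (ι ⊕ κ) (ι ⊕ κ) R), BlockDet Q D T 1 := by
    filter_upwards [A1, A2] with T ⟨s, hs, hs1⟩ ⟨d, hd, hd1⟩
    refine ⟨s, d, T.toBlocks₁₂ * ((d⁻¹ : (Matrix κ κ R)ˣ) : Matrix κ κ R),
      ((d⁻¹ : (Matrix κ κ R)ˣ) : Matrix κ κ R) * T.toBlocks₂₁, ?_, by simp [hs1, hd1]⟩
    conv_lhs => rw [← fromBlocks_toBlocks T]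
    simp only [f, ← hd, Ring.inverse_unit] at hs
    congr 1
    · have hcancel : T.toBlocks₁₂ * ((d⁻¹ : (Matrix κ κ R)ˣ) : Matrix κ κ R) * (d : Matrix κ κ R)
          = T.toBlocks₁₂ := by rw [Matrix.mul_assoc, Units.inv_mul, Matrix.mul_one]
      rw [hs, hcancel, ← Matrix.mul_assoc]
      simp
    · rw [Matrix.mul_assoc, Units.inv_mul, Matrix.mul_one]
    · rw [← Matrix.mul_assoc, Units.mul_inv, Matrix.one_mul]
    · exact hd.symm
  have := (Units.continuous_val (M := Matrix (ι ⊕ κ) (ι ⊕ κ) R)).tendsto 1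
  exact this.eventually A

theorem dense_isUnit_toBlocks₂₂ (hR : Dense {x : Matrix κ κ R | IsUnit x}) :
    Dense {T : (Matrix (ι ⊕ κ) (ι ⊕ κ) R)ˣ |
      IsUnit (T : Matrix (ι ⊕ κ) (ι ⊕ κ) R).toBlocks₂₂} := by
  rw [dense_iff_inter_open]
  rintro O hO ⟨T, hT⟩
  have h1 := Matrix.isOpenEmbedding_unitsVal.isOpenMap _ hO
  let f : Matrix κ κ R → Matrix (ι ⊕ κ) (ι ⊕ κ) R := fun d =>
    fromBlocks (T : Matrix (ι ⊕ κ) (ι ⊕ κ) R).toBlocks₁₁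
      (T : Matrix (ι ⊕ κ) (ι ⊕ κ) R).toBlocks₁₂ (T : Matrix (ι ⊕ κ) (ι ⊕ κ) R).toBlocks₂₁ d
  have hf : Continuous f :=
    continuous_const.matrix_fromBlocks continuous_const continuous_const continuous_id
  obtain ⟨d, hd, hdu⟩ := hR.inter_open_nonempty _ (h1.preimage hf)
    ⟨(T : Matrix (ι ⊕ κ) (ι ⊕ κ) R).toBlocks₂₂, T, hT, (fromBlocks_toBlocks _).symm⟩
  obtain ⟨V, hV, hVd⟩ := hd
  exact ⟨V, hV, by simpa [hVd, f] using hdu⟩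

theorem isOpen_isUnit_toBlocks₂₂ :
    IsOpen {T : (Matrix (ι ⊕ κ) (ι ⊕ κ) R)ˣ |
      IsUnit (T : Matrix (ι ⊕ κ) (ι ⊕ κ) R).toBlocks₂₂} := by
  have h : IsOpen (Set.range (Units.val : (Matrix κ κ R)ˣ → Matrix κ κ R)) :=
    Matrix.isOpenEmbedding_unitsVal.isOpen_range
  exact h.preimage ((continuous_id.matrix_submatrix Sum.inr Sum.inr).comp Units.continuous_val)

end Sum

end IsSylvesterExtension

namespace IsSylvesterExtension

section Sum

variable {ι κ R G : Type*} [Fintype ι] [DecidableEq ι] [Fintype κ] [DecidableEq κ]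
  [NormedRing R] [CompleteSpace R] [CommGroup G] {Q : (Matrix κ κ R)ˣ →* G}
  {D : (Matrix ι ι R)ˣ →* G}

/-- The determinant extends from the Gaussian-eliminable matrices to all invertible ones. -/
theorem exists_blockDet_extension (hR : Dense {x : Matrix κ κ R | IsUnit x})
    (hQ : ∀ᶠ u in 𝓝 (1 : (Matrix κ κ R)ˣ), Q u = 1) (hD : IsSylvesterExtension Q D) :
    ∃ E : (Matrix (ι ⊕ κ) (ι ⊕ κ) R)ˣ →* G, (∀ᶠ u in 𝓝 1, E u = 1) ∧
      ∀ (T : (Matrix (ι ⊕ κ) (ι ⊕ κ) R)ˣ) (g : G),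
        BlockDet Q D (T : Matrix (ι ⊕ κ) (ι ⊕ κ) R) g → E T = g := by
  let Ω : Set (Matrix (ι ⊕ κ) (ι ⊕ κ) R)ˣ := {T | IsUnit (T : Matrix (ι ⊕ κ) (ι ⊕ κ) R).toBlocks₂₂}
  have hΩo : IsOpen Ω := isOpen_isUnit_toBlocks₂₂
  have hΩd : Dense Ω := dense_isUnit_toBlocks₂₂ hR
  have hev := eventually_blockDet_one hQ hD
  obtain ⟨W, hW, hWo, hW1⟩ := eventually_nhds_iff.1 hev
  obtain ⟨V, hV, hVW⟩ : ∃ V : Set (Matrix (ι ⊕ κ) (ι ⊕ κ) R)ˣ, (IsOpen V ∧ (1 : (Matrix (ι ⊕ κ) (ι ⊕ κ) R)ˣ) ∈ V) ∧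
      ∀ S ∈ V, ∀ S' ∈ V, S⁻¹ * S' ∈ W := by
    have hc : Continuous (fun p : (Matrix (ι ⊕ κ) (ι ⊕ κ) R)ˣ × (Matrix (ι ⊕ κ) (ι ⊕ κ) R)ˣ => p.1⁻¹ * p.2) :=
      continuous_fst.inv.mul continuous_snd
    have : (fun p : (Matrix (ι ⊕ κ) (ι ⊕ κ) R)ˣ × (Matrix (ι ⊕ κ) (ι ⊕ κ) R)ˣ => p.1⁻¹ * p.2) ⁻¹' W ∈ 𝓝 ((1 : (Matrix (ι ⊕ κ) (ι ⊕ κ) R)ˣ), (1 : (Matrix (ι ⊕ κ) (ι ⊕ κ) R)ˣ)) :=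
      hc.continuousAt.preimage_mem_nhds (by simpa using hWo.mem_nhds hW1)
    rw [mem_nhds_prod_iff] at this
    obtain ⟨u, hu, v, hv, huv⟩ := this
    obtain ⟨V, hV, hVo, hV1⟩ := mem_nhds_iff.1 (inter_mem hu hv)
    exact ⟨V, ⟨hVo, hV1⟩, fun S hS S' hS' =>
      huv (Set.mk_mem_prod (hV hS).1 (hV hS').2)⟩
  obtain ⟨hVo, hV1⟩ := hV
  have hdense : ∀ T T' : (Matrix (ι ⊕ κ) (ι ⊕ κ) R)ˣ, Dense {S : (Matrix (ι ⊕ κ) (ι ⊕ κ) R)ˣ | T * S * T' ∈ Ω} := fun T T' =>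
    hΩd.preimage (f := fun S => T * S * T')
      ((Homeomorph.mulLeft T).trans (Homeomorph.mulRight T')).isOpenMap
  have hopen : ∀ T T' : (Matrix (ι ⊕ κ) (ι ⊕ κ) R)ˣ, IsOpen {S : (Matrix (ι ⊕ κ) (ι ⊕ κ) R)ˣ | T * S * T' ∈ Ω} := fun T T' =>
    hΩo.preimage (((Homeomorph.mulLeft T).trans (Homeomorph.mulRight T')).continuous)
  have hex : ∀ T : (Matrix (ι ⊕ κ) (ι ⊕ κ) R)ˣ, ∃ S ∈ V, ∃ g, BlockDet Q D ((T * S : (Matrix (ι ⊕ κ) (ι ⊕ κ) R)ˣ) : Matrix (ι ⊕ κ) (ι ⊕ κ) R) g := by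
    intro T
    obtain ⟨S, hS, hSΩ⟩ := (hdense T 1).inter_open_nonempty V hVo ⟨1, hV1⟩
    have h : T * S * 1 ∈ Ω := hSΩ
    rw [mul_one] at h
    exact ⟨S, hS, BlockDet.of_isUnit (T * S).isUnit h⟩
  have htrans : ∀ (T S S' : (Matrix (ι ⊕ κ) (ι ⊕ κ) R)ˣ) (g : G), S ∈ V → S' ∈ V → T * S' ∈ Ω →
      BlockDet Q D ((T * S : (Matrix (ι ⊕ κ) (ι ⊕ κ) R)ˣ) : Matrix (ι ⊕ κ) (ι ⊕ κ) R) g →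
      BlockDet Q D ((T * S' : (Matrix (ι ⊕ κ) (ι ⊕ κ) R)ˣ) : Matrix (ι ⊕ κ) (ι ⊕ κ) R) g := by
    intro T S S' g hS hS' hΩ h
    have e : T * S' = (T * S) * (S⁻¹ * S') := by group
    have := BlockDet.mul hD h (hW _ (hVW S hS S' hS')) (by rw [← Units.val_mul, ← e]; exact hΩ)
    rwa [← Units.val_mul, ← e, mul_one] at this
  choose S hSV E hE using hex
  have hval : ∀ (T S' : (Matrix (ι ⊕ κ) (ι ⊕ κ) R)ˣ) (g : G), S' ∈ V →
      BlockDet Q D ((T * S' : (Matrix (ι ⊕ κ) (ι ⊕ κ) R)ˣ) : Matrix (ι ⊕ κ) (ι ⊕ κ) R) g → E T = g := fun T S' g hS' h =>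
    (htrans T (S T) S' (E T) (hSV T) hS' h.isUnit_toBlocks₂₂ (hE T)).unique h
  have hval1 : ∀ (T : (Matrix (ι ⊕ κ) (ι ⊕ κ) R)ˣ) (g : G), BlockDet Q D (T : Matrix (ι ⊕ κ) (ι ⊕ κ) R) g → E T = g :=
    fun T g h => hval T 1 g hV1 (by rwa [mul_one])
  have hmul : ∀ T₁ T₂ : (Matrix (ι ⊕ κ) (ι ⊕ κ) R)ˣ, E (T₁ * T₂) = E T₁ * E T₂ := by
    intro T₁ T₂
    have hO : IsOpen (V ∩ {S₁ : (Matrix (ι ⊕ κ) (ι ⊕ κ) R)ˣ | T₂⁻¹ * S₁ * (T₂ * S T₂) ∈ V}) := by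
      refine hVo.inter (hVo.preimage ?_)
      exact (continuous_const.mul continuous_id).mul continuous_const
    obtain ⟨S₁, ⟨hS₁, hS₁'⟩, hΩ₁, hΩ₂⟩ := ((hdense T₁ 1).inter_of_isOpen_left
      (hdense T₁ (T₂ * S T₂)) (hopen T₁ 1)).inter_open_nonempty _ hO
      ⟨1, hV1, by
        have : T₂⁻¹ * 1 * (T₂ * S T₂) = S T₂ := by group
        simpa [this] using hSV T₂⟩
    have h1 : T₁ * S₁ ∈ Ω := by simpa using hΩ₁
    have b1 := htrans T₁ (S T₁) S₁ (E T₁) (hSV T₁) hS₁ h1 (hE T₁)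
    have b := BlockDet.mul hD b1 (hE T₂) (by rw [← Units.val_mul]; exact hΩ₂)
    refine hval _ _ _ hS₁' ?_
    rw [← Units.val_mul] at b
    convert b using 2
    group
  refine ⟨MonoidHom.mk' E hmul, ?_, hval1⟩
  filter_upwards [hev] with T hT using hval1 T 1 hT

theorem dense_isUnit_one_add_mul (hR : Dense {x : Matrix κ κ R | IsUnit x}) :
    Dense {p : Matrix κ κ R × Matrix κ κ R | IsUnit p.1 ∧ IsUnit (1 + p.2 * p.1)} := by
  intro p
  rw [mem_closure_iff_nhds]
  intro t ht
  rw [nhds_prod_eq, mem_prod_iff] at ht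
  obtain ⟨t₁, ht₁, t₂, ht₂, ht⟩ := ht
  obtain ⟨_, hx, ⟨x, rfl⟩⟩ := mem_closure_iff_nhds.1 (hR p.1) t₁ ht₁
  obtain ⟨y, hy, hyu⟩ := mem_closure_iff_nhds.1
    ((hR.preimage (Homeomorph.addLeft ((x⁻¹ : (Matrix κ κ R)ˣ) : Matrix κ κ R)).isOpenMap) p.2)
    t₂ ht₂
  refine ⟨((x : Matrix κ κ R), y), ht ⟨hx, hy⟩, x.isUnit, ?_⟩
  have : (1 : Matrix κ κ R) + y * x = (((x⁻¹ : (Matrix κ κ R)ˣ) : Matrix κ κ R) + y) * x := by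
    rw [add_mul, Units.inv_mul]
  change IsUnit (1 + y * (x : Matrix κ κ R))
  rw [this]
  exact IsUnit.mul hyu x.isUnit

theorem exists_sum (hR : Dense {x : Matrix κ κ R | IsUnit x})
    (hQ : IsSylvesterExtension Q Q) (hD : IsSylvesterExtension Q D) :
    ∃ E : (Matrix (ι ⊕ κ) (ι ⊕ κ) R)ˣ →* G, IsSylvesterExtension Q E := by
  obtain ⟨E, hE1, hE⟩ := exists_blockDet_extension hR hQ.eventually_eq_one hD
  refine ⟨E, hE1, ?_⟩
  have key : ∀ (y₁ : Matrix ι κ R) (y₀ : Matrix κ κ R) (x₁ : Matrix κ ι R) (x₀ : Matrix κ κ R)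
      (U : (Matrix (ι ⊕ κ) (ι ⊕ κ) R)ˣ) (u : (Matrix κ κ R)ˣ),
      (U : Matrix (ι ⊕ κ) (ι ⊕ κ) R) =
        fromBlocks (1 + y₁ * x₁) (y₁ * x₀) (y₀ * x₁) (1 + y₀ * x₀) →
      (u : Matrix κ κ R) = 1 + x₁ * y₁ + x₀ * y₀ →
      IsUnit (1 + x₀ * y₀) → IsUnit (1 + y₀ * x₀) → E U = Q u := by
    rintro y₁ y₀ x₁ x₀ U u hU hu ⟨e, he⟩ hd
    obtain ⟨g, hg⟩ := BlockDet.of_isUnit (Q := Q) (D := D) U.isUnit (by rw [hU]; simpa using hd)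
    rw [hE U g hg]
    obtain ⟨s, d, y, x, hs, rfl⟩ := hg
    rw [hU, fromBlocks_inj] at hs
    obtain ⟨h1, h2, h3, h4⟩ := hs
    set e' : Matrix κ κ R := ((e⁻¹ : (Matrix κ κ R)ˣ) : Matrix κ κ R) with he'
    have he'e : e' * (1 + x₀ * y₀) = 1 := by rw [← he]; simp [he', ← Units.val_mul]
    have hx : (d : Matrix κ κ R) * x = y₀ * x₁ := h3.symm
    have hxx : x = y₀ * e' * x₁ := by
      have : (d : Matrix κ κ R) * (y₀ * e' * x₁) = y₀ * x₁ := by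
        have hc : (d : Matrix κ κ R) * y₀ = y₀ * (1 + x₀ * y₀) := by
          rw [← h4]; noncomm_ring
        have hee' : (1 + x₀ * y₀) * e' = 1 := by rw [← he]; simp [he', ← Units.val_mul]
        calc _ = (d : Matrix κ κ R) * y₀ * e' * x₁ := by simp only [Matrix.mul_assoc]
          _ = y₀ * ((1 + x₀ * y₀) * e') * x₁ := by rw [hc]; simp only [Matrix.mul_assoc]
          _ = _ := by rw [hee']; simp
      have h := congrArg (((d⁻¹ : (Matrix κ κ R)ˣ) : Matrix κ κ R) * ·) (hx.trans this.symm)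
      simpa [← Matrix.mul_assoc, ← Units.val_mul] using h
    have hsv : (s : Matrix ι ι R) = 1 + y₁ * (e' * x₁) := by
      have : (s : Matrix ι ι R) = 1 + y₁ * x₁ - y₁ * x₀ * x := by
        rw [h2, h1]; simp
      rw [this, hxx]
      have h' : e' = 1 - x₀ * y₀ * e' := by
        have hee' : (1 + x₀ * y₀) * e' = 1 := by rw [← he]; simp [he', ← Units.val_mul]
        rw [add_mul, one_mul] at hee'
        exact eq_sub_of_add_eq hee'
      conv_rhs => rw [h']
      simp only [Matrix.mul_sub, Matrix.sub_mul, Matrix.one_mul, Matrix.mul_assoc]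
      abel
    have hDs : D s = Q (e⁻¹ * u) := by
      refine hD.sylvester _ _ _ _ hsv ?_
      rw [Units.val_mul, hu, ← he', add_right_comm, Matrix.mul_add, he'e, Matrix.mul_assoc]
    have hde : Q d = Q e := hQ.sylvester y₀ x₀ d e h4.symm he
    rw [hDs, hde, map_mul, map_inv]
    simp [mul_comm]
  intro y x U u hU hu
  set y₁ := y.toRows₁
  set y₀ := y.toRows₂
  set x₁ := x.toCols₁
  set x₀ := x.toCols₂
  have hy : y = fromRows y₁ y₀ := (fromRows_toRows y).symm
  have hx : x = fromCols x₁ x₀ := (fromCols_toCols x).symm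
  let F : Matrix κ κ R × Matrix κ κ R → Matrix (ι ⊕ κ) (ι ⊕ κ) R := fun p =>
    fromBlocks (1 + y₁ * x₁) (y₁ * p.1) (p.2 * x₁) (1 + p.2 * p.1)
  let f : Matrix κ κ R × Matrix κ κ R → Matrix κ κ R := fun p => 1 + x₁ * y₁ + p.1 * p.2
  have hF : Continuous F := continuous_const.matrix_fromBlocks
    (continuous_const.matrix_mul continuous_fst) (continuous_snd.matrix_mul continuous_const)
    (continuous_const.add (continuous_snd.matrix_mul continuous_fst))
  have hf : Continuous f := continuous_const.add (continuous_fst.matrix_mul continuous_snd)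
  have hFU : F (x₀, y₀) = U := by
    rw [hU, hy, hx, fromRows_mul_fromCols, ← fromBlocks_one, fromBlocks_add]
    simp [F]
  have hfu : f (x₀, y₀) = u := by
    rw [hu, hy, hx, fromCols_mul_fromRows]
    simp [f, add_assoc]
  have A1 := hF.continuousAt.eventually (by rw [hFU]; exact eventually_exists_unit hE1 U)
  have A2 := hf.continuousAt.eventually
    (by rw [hfu]; exact eventually_exists_unit hQ.eventually_eq_one u)
  obtain ⟨⟨p₁, p₂⟩, ⟨⟨U', hU', hU1⟩, ⟨u', hu', hu1⟩⟩, h1, h2⟩ := mem_closure_iff_nhds.1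
    (dense_isUnit_one_add_mul hR (x₀, y₀)) _ (A1.and A2)
  rw [← hU1, ← hu1]
  refine key y₁ p₂ x₁ p₁ U' u' hU' hu' ?_ h2
  obtain ⟨v, rfl⟩ := h1
  have : (1 : Matrix κ κ R) + v * p₂ =
      v * (1 + p₂ * v) * ((v⁻¹ : (Matrix κ κ R)ˣ) : Matrix κ κ R) := by
    simp [mul_add, add_mul, mul_assoc]
  rw [this]
  exact (v.isUnit.mul h2).mul (v⁻¹).isUnit

end Sum

theorem exists_reindex {ι ι' κ R G : Type*} [Fintype ι] [DecidableEq ι] [Fintype ι']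
    [DecidableEq ι'] [Fintype κ] [DecidableEq κ]
    [NormedRing R] [CommGroup G] {Q : (Matrix κ κ R)ˣ →* G} {D : (Matrix ι ι R)ˣ →* G}
    (hD : IsSylvesterExtension Q D) (e : ι' ≃ ι) :
    ∃ E : (Matrix ι' ι' R)ˣ →* G, IsSylvesterExtension Q E := by
  let φ : (Matrix ι' ι' R)ˣ →* (Matrix ι ι R)ˣ :=
    Units.map ((Matrix.reindexRingEquiv R e : Matrix ι' ι' R ≃+* Matrix ι ι R) :
      Matrix ι' ι' R →* Matrix ι ι R)
  have hφ : Continuous φ := by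
    refine Continuous.units_map _ ?_
    exact continuous_id.matrix_reindex e e
  refine ⟨D.comp φ, ?_, ?_⟩
  · have := hφ.tendsto 1
    rw [map_one] at this
    exact this.eventually hD.eventually_eq_one
  · intro y x U u hU hu
    refine hD.sylvester (y.submatrix e.symm id) (x.submatrix id e.symm) (φ U) u ?_ ?_
    · change (U : Matrix ι' ι' R).submatrix e.symm e.symm = _
      rw [hU, Matrix.submatrix_add, Pi.add_apply, Pi.add_apply, Matrix.submatrix_one_equiv]
      congr 1
    · rw [hu]
      congr 1
      ext i j
      simp only [Matrix.mul_apply, Matrix.submatrix_apply, id]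
      exact (Equiv.sum_comp e.symm (fun k => x i k * y k j)).symm

theorem exists_fin {R G : Type*} [NormedRing R] [CompleteSpace R] [CommGroup G] {Q : (Matrix (Fin 1) (Fin 1) R)ˣ →* G}
    (hR : Dense {x : Matrix (Fin 1) (Fin 1) R | IsUnit x})
    (hQ : IsSylvesterExtension Q Q) (k : ℕ) :
    ∃ E : (Matrix (Fin k) (Fin k) R)ˣ →* G, IsSylvesterExtension Q E := by
  induction k with
  | zero =>
    refine ⟨1, by simp, fun y x U u hU hu => ?_⟩
    have : u = 1 := Units.ext (by
      rw [hu]; ext i j; simp [Matrix.mul_apply])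
    simp [this]
  | succ k ih =>
    obtain ⟨D, hD⟩ := ih
    obtain ⟨E, hE⟩ := exists_sum hR hQ hD
    exact exists_reindex hE finSumFinEquiv.symm

end IsSylvesterExtension

/-- If a unitary becomes connected to `1` after stabilization, then a group-valued
determinant does not see it. -/
theorem Matrix.eq_one_of_joined_fromBlocks {R G : Type*}
    [NormedRing R] [CompleteSpace R] [CommGroup G] {Q : (Matrix (Fin 1) (Fin 1) R)ˣ →* G}
    (hR : Dense {x : Matrix (Fin 1) (Fin 1) R | IsUnit x})
    (hQ : IsSylvesterExtension Q Q) (k : ℕ) (u : (Matrix (Fin 1) (Fin 1) R)ˣ)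
    (U : (Matrix (Fin 1 ⊕ Fin k) (Fin 1 ⊕ Fin k) R)ˣ)
    (hU : (U : Matrix (Fin 1 ⊕ Fin k) (Fin 1 ⊕ Fin k) R) =
      fromBlocks (u : Matrix (Fin 1) (Fin 1) R) 0 0 1)
    (hj : Joined 1 U) : Q u = 1 := by
  obtain ⟨E₀, hE₀⟩ := IsSylvesterExtension.exists_fin hR hQ (1 + k)
  obtain ⟨E, hE⟩ := IsSylvesterExtension.exists_reindex hE₀ finSumFinEquiv
  have h1 : E U = Q u := by
    refine hE.sylvester (fromRows ((u : Matrix (Fin 1) (Fin 1) R) - 1) 0) (fromCols 1 0) U u ?_ ?_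
    · rw [hU, fromRows_mul_fromCols, ← fromBlocks_one, fromBlocks_add]
      simp
    · rw [fromCols_mul_fromRows]
      simp
  have hloc : IsLocallyConstant E := by
    rw [IsLocallyConstant.iff_eventually_eq]
    intro V
    have hc : Tendsto (fun W : (Matrix (Fin 1 ⊕ Fin k) (Fin 1 ⊕ Fin k) R)ˣ => V⁻¹ * W)
        (𝓝 V) (𝓝 1) := by
      have : Continuous
          (fun W : (Matrix (Fin 1 ⊕ Fin k) (Fin 1 ⊕ Fin k) R)ˣ => V⁻¹ * W) :=
        continuous_const.mul continuous_id
      simpa using this.tendsto V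
    filter_upwards [hc.eventually hE.eventually_eq_one] with W hW
    rw [map_mul, map_inv, inv_mul_eq_one] at hW
    exact hW.symm
  obtain ⟨γ⟩ := hj
  have hγ : IsLocallyConstant (E ∘ γ) := hloc.comp_continuous γ.continuous
  have := hγ.apply_eq_of_preconnectedSpace 0 1
  simp only [Function.comp, γ.source, γ.target, map_one] at this
  rw [← h1, ← this]

end

section

universe v

open Topology Filter

section Ring

variable {R : Type*} [NormedRing R] [NormedAlgebra ℝ R]

theorem JoinedIn.mul_isUnit {x y x' y' : R} (h : JoinedIn {z : R | IsUnit z} x y)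
    (h' : JoinedIn {z : R | IsUnit z} x' y') : JoinedIn {z : R | IsUnit z} (x * x') (y * y') := by
  refine (h.mul h').mono ?_
  rintro _ ⟨a, ha, b, hb, rfl⟩
  exact IsUnit.mul ha hb

theorem isUnit_one_add_mul_swap {a b : R} (h : IsUnit (1 + a * b)) : IsUnit (1 + b * a) := by
  obtain ⟨u, hu⟩ := h
  set v : R := ((u⁻¹ : Rˣ) : R)
  have h1 : (1 + a * b) * v = 1 := by rw [← hu]; simp [v]
  have h2 : v * (1 + a * b) = 1 := by rw [← hu]; simp [v]
  refine ⟨⟨1 + b * a, 1 - b * v * a, ?_, ?_⟩, rfl⟩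
  · calc (1 + b * a) * (1 - b * v * a) = 1 + b * a - b * ((1 + a * b) * v) * a := by noncomm_ring
      _ = 1 := by rw [h1]; noncomm_ring
  · calc (1 - b * v * a) * (1 + b * a) = 1 + b * a - b * (v * (1 + a * b)) * a := by noncomm_ring
      _ = 1 := by rw [h2]; noncomm_ring

/-- A unit which almost fixes `k` conjugates `1 + k` within its path component. -/
theorem joinedIn_conj_one_add (w : Rˣ) {k : R} {ρ : ℝ}
    (hρ : Metric.ball (1 + k) ρ ⊆ {z : R | IsUnit z}) (hw : ‖(w : R) * k - k‖ < ρ) :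
    JoinedIn {z : R | IsUnit z} (w * (1 + k) * ((w⁻¹ : Rˣ) : R)) (1 + k) := by
  set w' : R := ((w⁻¹ : Rˣ) : R)
  have hww : w' * w = 1 := by simp [w']
  have hww' : (w : R) * w' = 1 := by simp [w']
  have hρ0 : 0 < ρ := (norm_nonneg _).trans_lt hw
  have h1 : JoinedIn {z : R | IsUnit z} (w * (1 + k) * w') (1 + w * k) := by
    refine JoinedIn.ofLine (f := fun t : ℝ => 1 + w * k * ((1 - t) • w' + t • (1 : R))) ?_ ?_ ?_ ?_
    · fun_prop
    · simp [mul_add, add_mul, hww']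
    · simp
    · rintro _ ⟨t, ht, rfl⟩
      refine isUnit_one_add_mul_swap (hρ ?_)
      rw [mem_ball_iff_norm]
      have : 1 + ((1 - t) • w' + t • (1 : R)) * (w * k) - (1 + k) = t • (w * k - k) := by
        rw [add_mul, smul_mul_assoc, ← mul_assoc, hww]
        simp only [one_mul, sub_smul, smul_sub, one_smul, smul_mul_assoc]
        abel
      rw [this, norm_smul, Real.norm_of_nonneg ht.1]
      exact (mul_le_of_le_one_left (norm_nonneg _) ht.2).trans_lt hw
  refine h1.trans (JoinedIn.of_segment_subset ?_)
  refine ((convex_ball (1 + k) ρ).segment_subset ?_ (Metric.mem_ball_self hρ0)).trans hρ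
  rw [mem_ball_iff_norm]
  simpa using hw

end Ring

section CStar

variable {R : Type*} [CStarAlgebra R]

section Order

variable [PartialOrder R] [StarOrderedRing R]

theorem exists_unitary_mul_abs (v : Rˣ) : ∃ (w : unitary R) (p : R), IsStrictlyPositive p ∧
    p * p = star (v : R) * v ∧ (v : R) = w * p := by
  have hp0 : 0 ≤ CFC.abs (v : R) := CFC.abs_nonneg _
  have hpp := CFC.abs_mul_abs (v : R)
  set p := CFC.abs (v : R)
  have hpu : IsUnit p := by
    have : IsUnit (p * p) := by rw [hpp]; exact (v.isUnit.star).mul v.isUnit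
    exact (Commute.refl p).isUnit_mul_iff.1 this |>.1
  have hsa : IsSelfAdjoint p := hp0.isSelfAdjoint
  obtain ⟨q, hq⟩ := hpu
  set q' : R := ((q⁻¹ : Rˣ) : R)
  have h1 : p * q' = 1 := by rw [← hq]; simp [q']
  have h2 : q' * p = 1 := by rw [← hq]; simp [q']
  have hq' : star q' = q' := by
    have : star q' * p = 1 := by
      rw [← hsa.star_eq, ← star_mul, h1, star_one]
    calc star q' = star q' * (p * q') := by rw [h1, mul_one]
      _ = q' := by rw [← mul_assoc, this, one_mul]
  have hs : star ((v : R) * q') * (v * q') = 1 := by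
    rw [star_mul, hq']
    calc q' * star (v : R) * (v * q') = q' * (star (v : R) * v) * q' := by simp only [mul_assoc]
      _ = (q' * p) * (p * q') := by rw [← hpp]; simp only [mul_assoc]
      _ = 1 := by rw [h1, h2, one_mul]
  have hu : IsUnit ((v : R) * q') := v.isUnit.mul (q⁻¹).isUnit
  have hs' : (v : R) * q' * star ((v : R) * q') = 1 := by
    obtain ⟨a, ha⟩ := hu
    rw [← ha] at hs ⊢
    have : star (a : R) = ((a⁻¹ : Rˣ) : R) := by
      rw [← mul_one (star (a : R)), ← a.mul_inv, ← mul_assoc, hs, one_mul]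
    rw [this, a.mul_inv]
  refine ⟨⟨v * q', Unitary.mem_iff.2 ⟨hs, hs'⟩⟩, p, IsUnit.isStrictlyPositive ⟨q, hq⟩ hp0, hpp, ?_⟩
  rw [mul_assoc, h2, mul_one]

theorem IsStrictlyPositive.joinedIn_one {p : R} (hp : IsStrictlyPositive p) :
    JoinedIn {z : R | IsUnit z} p 1 := by
  refine JoinedIn.ofLine (f := fun t : ℝ => (1 - t) • p + t • (1 : R)) (by fun_prop)
    (by simp) (by simp) ?_
  rintro _ ⟨t, ht, rfl⟩
  rcases eq_or_lt_of_le ht.1 with rfl | h0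
  · simpa using hp.isUnit
  · have h1 : IsStrictlyPositive (t • (1 : R)) := by
      refine IsUnit.isStrictlyPositive ?_ (smul_nonneg h0.le zero_le_one)
      rw [← Algebra.algebraMap_eq_smul_one]
      exact (IsUnit.mk0 t h0.ne').map (algebraMap ℝ R)
    exact (h1.nonneg_add (smul_nonneg (by linarith [ht.2]) hp.nonneg)).isUnit

end Order

theorem exists_unitary_joinedIn (v : Rˣ) :
    ∃ w : unitary R, JoinedIn {z : R | IsUnit z} (v : R) (w : R) := by
  let _ := CStarAlgebra.spectralOrder R
  have := CStarAlgebra.spectralOrderedRing R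
  obtain ⟨w, p, hp, -, hv⟩ := exists_unitary_mul_abs v
  refine ⟨w, ?_⟩
  have hw : IsUnit (w : R) := (Unitary.toUnits w).isUnit
  have := (JoinedIn.refl (F := {z : R | IsUnit z}) hw).mul_isUnit hp.joinedIn_one
  rwa [← hv, mul_one] at this

/-- A bump on the right half of the circle winding once around `1`. -/
noncomputable def circleBump (z : ℂ) : ℂ := ((max (z.re - 1 / 2) 0 : ℝ) : ℂ) * (4 + z.im * Complex.I)

theorem continuous_circleBump : Continuous circleBump := by
  unfold circleBump; fun_prop

theorem segment_circleBump_ne_zero {z : ℂ} (hz : ‖z‖ = 1) {t : ℝ} (ht : t ∈ Set.Icc (0 : ℝ) 1) :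
    ((1 - t : ℝ) : ℂ) * z + (t : ℂ) * (circleBump z - 1) ≠ 0 := by
  intro h
  have hz2 : z.re * z.re + z.im * z.im = 1 := by
    rw [← Complex.normSq_apply, Complex.normSq_eq_norm_sq, hz]; norm_num
  have hre := congrArg Complex.re h
  have him := congrArg Complex.im h
  simp [circleBump] at hre him
  obtain ⟨h0, h1⟩ := ht
  rcases le_total z.re (1 / 2) with hc | hc
  · rw [max_eq_right (by linarith)] at hre him
    simp at hre him
    rcases him with him | him
    · have : t = 1 := by linarith
      subst this; norm_num at hre
    · rw [him] at hz2
      have : (z.re - 1) * (z.re + 1) = 0 := by linarith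
      rcases mul_eq_zero.1 this with h | h
      · linarith
      · have : z.re = -1 := by linarith
        rw [this] at hre; linarith
  · rw [max_eq_left (by linarith)] at hre him
    have : z.im * ((1 - t) + t * (z.re - 1 / 2)) = 0 := by linarith
    rcases mul_eq_zero.1 this with h | h
    · rw [h] at hz2
      have : (z.re - 1) * (z.re + 1) = 0 := by linarith
      rcases mul_eq_zero.1 this with h | h
      · have : z.re = 1 := by linarith
        rw [this] at hre; linarith
      · linarith
    · have h3 : 0 ≤ t * (z.re - 1 / 2) := mul_nonneg h0 (by linarith)
      have : t = 1 := by linarith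
      subst this
      have : z.re = 1 / 2 := by linarith
      rw [this] at hre; norm_num at hre

theorem Unitary.joinedIn_cfc_circleBump (v : unitary R) :
    JoinedIn {z : R | IsUnit z} (v : R) (cfc circleBump (v : R) - 1) := by
  have hc : ContinuousOn circleBump (spectrum ℂ (v : R)) := continuous_circleBump.continuousOn
  refine JoinedIn.ofLine
    (f := fun t : ℝ => ((1 - t : ℝ) : ℂ) • (v : R) + (t : ℂ) • (cfc circleBump (v : R) - 1))
    (by fun_prop) (by simp) (by simp) ?_
  rintro _ ⟨t, ht, rfl⟩
  have e : ((1 - t : ℝ) : ℂ) • (v : R) + (t : ℂ) • (cfc circleBump (v : R) - 1) =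
      cfc (fun z => ((1 - t : ℝ) : ℂ) * z + (t : ℂ) * (circleBump z - 1)) (v : R) := by
    rw [cfc_add .., cfc_const_mul .., cfc_const_mul .., cfc_sub .., cfc_id' ℂ (v : R),
      cfc_const_one ℂ (v : R)]
  change IsUnit (_ : R)
  simp only
  rw [e, isUnit_cfc_iff _ _ (by fun_prop)]
  intro z hz
  exact segment_circleBump_ne_zero (by simpa using spectrum.norm_eq_one_of_unitary v.2 hz) ht

theorem IsUnit.joinedIn_neg {x : R} (hx : IsUnit x) : JoinedIn {z : R | IsUnit z} x (-x) := by
  refine JoinedIn.ofLine (f := fun t : ℝ => Complex.exp (t * (Real.pi * Complex.I)) • x)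
    (by fun_prop) (by simp) (by simp [Complex.exp_pi_mul_I]) ?_
  rintro _ ⟨t, -, rfl⟩
  change IsUnit (_ • x)
  rw [Algebra.smul_def]
  exact ((IsUnit.mk0 _ (Complex.exp_ne_zero _)).map (algebraMap ℂ R)).mul hx

/-- A unitary is homotopic to two units that differ from `1` on disjoint parts. -/
theorem Unitary.exists_joinedIn_one_add (v : unitary R) : ∃ k₁ k₂ e : R, e * k₁ = k₁ ∧ e * k₂ = 0 ∧
    JoinedIn {z : R | IsUnit z} (v : R) (1 + k₁) ∧
    JoinedIn {z : R | IsUnit z} (v : R) (1 + k₂) := by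
  have key : ∀ v : unitary R,
      JoinedIn {z : R | IsUnit z} (v : R) (1 + -cfc circleBump (v : R)) := by
    intro v
    have h := Unitary.joinedIn_cfc_circleBump v
    have := h.trans (IsUnit.joinedIn_neg h.target_mem)
    convert this using 1
    abel
  refine ⟨-cfc circleBump (v : R), -cfc (fun z => circleBump (-z)) (v : R),
    cfc (fun z : ℂ => ((max 0 (min 1 (z.re + 1 / 2)) : ℝ) : ℂ)) (v : R), ?_, ?_, key v, ?_⟩
  · have hc : Continuous circleBump := continuous_circleBump
    rw [mul_neg, ← cfc_mul _ _ _ (by fun_prop) (by fun_prop)]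
    congr 2
    funext z
    by_cases h : z.re ≤ 1 / 2
    · have : max (z.re - 1 / 2) 0 = 0 := max_eq_right (sub_nonpos.2 h)
      rw [circleBump, this]; simp
    · rw [min_eq_left (by linarith)]; simp
  · have hc : Continuous circleBump := continuous_circleBump
    rw [mul_neg, ← cfc_mul _ _ _ (by fun_prop) (by fun_prop), neg_eq_zero]
    convert cfc_const_zero ℂ (v : R) using 2
    funext z
    by_cases h : z.re ≤ - (1 / 2)
    · rw [max_eq_left]
      · simp
      · exact (min_le_right _ _).trans (by linarith)
    · have : max ((-z).re - 1 / 2) 0 = 0 := max_eq_right (by simp; linarith)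
      rw [circleBump, this]; simp
  · have h := key (-v)
    have e : cfc circleBump ((-v : unitary R) : R) = cfc (fun z => circleBump (-z)) (v : R) := by
      have hc : Continuous circleBump := continuous_circleBump
      rw [cfc_comp_neg _ _ (by fun_prop)]
      rfl
    rw [e] at h
    refine (IsUnit.joinedIn_neg (x := (v : R)) (Unitary.toUnits v).isUnit).trans ?_
    exact h

theorem exists_ball_subset_isUnit {x : R} (hx : IsUnit x) :
    ∃ ρ > 0, Metric.ball x ρ ⊆ {z : R | IsUnit z} :=
  Metric.isOpen_iff.1 Units.isOpen x hx

/-- If the units of a C⋆-algebra are dense, its group of units is commutative up to homotopy. -/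
theorem joinedIn_conj (hR : Dense {x : R | IsUnit x}) (u v : Rˣ) :
    JoinedIn {z : R | IsUnit z} ((u * v * u⁻¹ : Rˣ) : R) v := by
  obtain ⟨v₀, hv₀⟩ := exists_unitary_joinedIn v
  obtain ⟨k₁, k₂, e, he₁, he₂, hk₁, hk₂⟩ := Unitary.exists_joinedIn_one_add v₀
  replace hk₁ := hv₀.trans hk₁
  replace hk₂ := hv₀.trans hk₂
  obtain ⟨ρ₁, hρ₁, hb₁⟩ := exists_ball_subset_isUnit hk₁.target_mem
  obtain ⟨ρ₂, hρ₂, hb₂⟩ := exists_ball_subset_isUnit hk₂.target_mem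
  set c : R := u * (1 - e) + e
  have hc₁ : c * k₁ - k₁ = 0 := by
    simp only [c, add_mul, mul_assoc, sub_mul, one_mul, he₁]; simp
  have hc₂ : ((u⁻¹ : Rˣ) : R) * c * k₂ - k₂ = 0 := by
    simp only [c, add_mul, mul_assoc, sub_mul, one_mul, he₂]; simp
  have ho : {w : R | ‖w * k₁ - k₁‖ < ρ₁} ∩ {w : R | ‖((u⁻¹ : Rˣ) : R) * w * k₂ - k₂‖ < ρ₂} ∈ 𝓝 c := by
    refine inter_mem ?_ ?_
    · exact (by fun_prop : Continuous fun w : R => ‖w * k₁ - k₁‖).continuousAt.eventually_lt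
        continuousAt_const (by simpa [hc₁] using hρ₁)
    · exact (by fun_prop : Continuous fun w : R => ‖((u⁻¹ : Rˣ) : R) * w * k₂ - k₂‖).continuousAt.eventually_lt
        continuousAt_const (by simpa [hc₂] using hρ₂)
  obtain ⟨_, ⟨hw₁, hw₂⟩, ⟨w, rfl⟩⟩ := mem_closure_iff_nhds.1 (hR c) _ ho
  have hconj : ∀ (g : Rˣ) {x y : R}, JoinedIn {z : R | IsUnit z} x y →
      JoinedIn {z : R | IsUnit z} (g * x * ((g⁻¹ : Rˣ) : R)) (g * y * ((g⁻¹ : Rˣ) : R)) :=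
    fun g x y h => ((JoinedIn.refl (F := {z : R | IsUnit z}) g.isUnit).mul_isUnit h).mul_isUnit
      (JoinedIn.refl (F := {z : R | IsUnit z}) (g⁻¹).isUnit)
  set r : Rˣ := u⁻¹ * w
  have h1 := joinedIn_conj_one_add w hb₁ hw₁
  have h2 := joinedIn_conj_one_add r hb₂ (by simpa [r] using hw₂)
  have h3 : JoinedIn {z : R | IsUnit z} ((r⁻¹ * v * r : Rˣ) : R) v := by
    have a := hconj r⁻¹ (hk₂.trans h2.symm)
    rw [inv_inv] at a
    have e1 : ((r⁻¹ : Rˣ) : R) * (r * (1 + k₂) * ((r⁻¹ : Rˣ) : R)) * (r : R) = 1 + k₂ := by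
      simp only [← mul_assoc, Units.inv_mul, one_mul]
      simp only [mul_assoc, Units.inv_mul, mul_one]
    rw [e1] at a
    simpa using a.trans hk₂.symm
  have h4 := hconj w h3
  have h5 := ((hconj w hk₁).trans h1).trans hk₁.symm
  have h6 := h4.trans h5
  have : u * v * u⁻¹ = w * (r⁻¹ * v * r) * w⁻¹ := by simp [r, mul_assoc]
  rw [this]
  simpa using h6

end CStar

section CStar

variable {R : Type*} [CStarAlgebra R]

/-- The units in the path component of `1`. -/
def unitsPathComponentOne (R : Type*) [CStarAlgebra R] : Subgroup Rˣ where
  carrier := {u | JoinedIn {z : R | IsUnit z} (u : R) 1}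
  one_mem' := JoinedIn.refl (F := {z : R | IsUnit z}) isUnit_one
  mul_mem' := fun {a b} ha hb => by
    have := JoinedIn.mul_isUnit ha hb
    simpa using this
  inv_mem' := fun {a} ha => by
    have := (JoinedIn.refl (F := {z : R | IsUnit z}) (a⁻¹).isUnit).mul_isUnit ha
    simpa using this.symm

theorem unitsPathComponentOne_normal (hR : Dense {x : R | IsUnit x}) :
    (unitsPathComponentOne R).Normal :=
  ⟨fun n hn g => (joinedIn_conj hR g n).trans hn⟩

theorem commutator_mem_unitsPathComponentOne (hR : Dense {x : R | IsUnit x}) (a b : Rˣ) :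
    (a * b)⁻¹ * (b * a) ∈ unitsPathComponentOne R := by
  have h := joinedIn_conj hR (a * b)⁻¹ b
  have h' := (JoinedIn.refl (F := {z : R | IsUnit z}) (b⁻¹).isUnit)
  have h2 := h.mul_isUnit h'
  have e : (a * b)⁻¹ * b * (a * b)⁻¹⁻¹ * b⁻¹ = (a * b)⁻¹ * (b * a) := by group
  rw [← Units.val_mul, ← Units.val_mul, e, mul_inv_cancel] at h2
  exact h2

theorem eventually_joinedIn (u : Rˣ) : ∀ᶠ v in 𝓝 (u : R), JoinedIn {z : R | IsUnit z} v u := by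
  obtain ⟨ρ, hρ, hb⟩ := exists_ball_subset_isUnit u.isUnit
  filter_upwards [Metric.ball_mem_nhds _ hρ] with v hv
  exact JoinedIn.of_segment_subset
    (((convex_ball (u : R) ρ).segment_subset hv (Metric.mem_ball_self hρ)).trans hb)

theorem joinedIn_one_add_mul_swap (hR : Dense {x : R | IsUnit x}) (x y : R)
    (h : IsUnit (1 + x * y)) :
    JoinedIn {z : R | IsUnit z} (1 + y * x) (1 + x * y) := by
  obtain ⟨u, hu⟩ := h
  obtain ⟨v, hv⟩ := isUnit_one_add_mul_swap (a := x) (b := y) ⟨u, hu⟩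
  have h1 : ∀ᶠ x' in 𝓝 x, JoinedIn {z : R | IsUnit z} (1 + x' * y) (1 + x * y) := by
    have := eventually_joinedIn u
    rw [hu] at this
    exact (by fun_prop : Continuous fun x' => 1 + x' * y).continuousAt.eventually this
  have h2 : ∀ᶠ x' in 𝓝 x, JoinedIn {z : R | IsUnit z} (1 + y * x') (1 + y * x) := by
    have := eventually_joinedIn v
    rw [hv] at this
    exact (by fun_prop : Continuous fun x' => 1 + y * x').continuousAt.eventually this
  obtain ⟨_, ⟨h1, h2⟩, ⟨w, rfl⟩⟩ := mem_closure_iff_nhds.1 (hR x) _ (h1.and h2)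
  refine h2.symm.trans (JoinedIn.trans ?_ h1)
  obtain ⟨g, hg⟩ := h2.source_mem
  have := (joinedIn_conj hR w g).symm
  convert this using 1
  · exact hg.symm
  · simp [hg, mul_add, add_mul, mul_assoc]

/-- The `K₁`-like quotient of the units detects the path component of `1` and
satisfies Sylvester's identity. -/
theorem exists_units_invariant {R : Type v} [CStarAlgebra R] (hR : Dense {x : R | IsUnit x}) :
    ∃ (G : Type v) (_ : CommGroup G) (q : Rˣ →* G),
      (∀ u, q u = 1 ↔ JoinedIn {z : R | IsUnit z} (u : R) 1) ∧
      ∀ (x y : R) (U V : Rˣ), (U : R) = 1 + y * x → (V : R) = 1 + x * y → q U = q V := by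
  have := unitsPathComponentOne_normal hR
  let inst : CommGroup (Rˣ ⧸ unitsPathComponentOne R) :=
    { QuotientGroup.Quotient.group (unitsPathComponentOne R) with
      mul_comm := by
        rintro ⟨a⟩ ⟨b⟩
        exact QuotientGroup.eq.2 (commutator_mem_unitsPathComponentOne hR a b) }
  refine ⟨Rˣ ⧸ unitsPathComponentOne R, inst, QuotientGroup.mk' (unitsPathComponentOne R),
    fun u => QuotientGroup.eq_one_iff u, fun x y U V hU hV => QuotientGroup.eq.2 ?_⟩
  have h := joinedIn_one_add_mul_swap hR x y (hV ▸ V.isUnit)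
  rw [← hU, ← hV] at h
  have := (JoinedIn.refl (F := {z : R | IsUnit z}) (U⁻¹).isUnit).mul_isUnit h
  rw [← Units.val_mul, ← Units.val_mul, inv_mul_cancel] at this
  exact this.symm

/-- In a C⋆-algebra with dense units, a unitary which is stably connected to `1` is connected
to `1` through units. -/
theorem joinedIn_one_of_joined_fromBlocks {R : Type v} [CStarAlgebra R]
    (hR : Dense {x : R | IsUnit x}) {u : R} {k : ℕ} (hu : IsUnit u)
    (U : (Matrix (Fin 1 ⊕ Fin k) (Fin 1 ⊕ Fin k) R)ˣ)
    (hU : (U : Matrix (Fin 1 ⊕ Fin k) (Fin 1 ⊕ Fin k) R) =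
      Matrix.fromBlocks (Matrix.of fun _ _ => u) 0 0 1) (hj : Joined 1 U) :
    JoinedIn {z : R | IsUnit z} u 1 := by
  obtain ⟨u, rfl⟩ := hu
  obtain ⟨G, _, q, hq, hqs⟩ := exists_units_invariant hR
  let φ : Matrix (Fin 1) (Fin 1) R ≃+* R :=
    { toFun := fun m => m 0 0
      invFun := fun x => Matrix.of fun _ _ => x
      left_inv := fun m => by ext i j; rw [Subsingleton.elim i 0, Subsingleton.elim j 0]; rfl
      right_inv := fun x => rfl
      map_mul' := fun a b => by simp [Matrix.mul_apply]
      map_add' := fun a b => rfl }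
  have hφ : ∀ m, φ m = m 0 0 := fun m => rfl
  have hφc : Continuous φ := continuous_id.matrix_elem 0 0
  have hφo : IsOpenMap φ := by
    have h1 : Continuous (fun x : R => (Matrix.of fun _ _ => x : Matrix (Fin 1) (Fin 1) R)) :=
      continuous_matrix fun _ _ => continuous_id
    intro s hs
    convert hs.preimage h1
    ext x
    constructor
    · rintro ⟨m, hm, rfl⟩
      change Matrix.of (fun _ _ => φ m) ∈ s
      convert hm
      ext i j
      rw [Subsingleton.elim i 0, Subsingleton.elim j 0]; rfl
    · intro hx
      exact ⟨_, hx, rfl⟩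
  let Q : (Matrix (Fin 1) (Fin 1) R)ˣ →* G := q.comp (Units.map (φ : _ →* R))
  have hd : Dense {x : Matrix (Fin 1) (Fin 1) R | IsUnit x} := by
    have := hR.preimage hφo
    convert this using 1
    ext m
    simp
  have hQ : IsSylvesterExtension Q Q := by
    refine ⟨?_, ?_⟩
    · have h : ∀ᶠ v : R in 𝓝 1, JoinedIn {z : R | IsUnit z} v 1 := eventually_joinedIn 1
      have hc : Continuous fun v : (Matrix (Fin 1) (Fin 1) R)ˣ => φ v :=
        hφc.comp Units.continuous_val
      have h' := hc.continuousAt (x := 1)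
      filter_upwards [h'.eventually (by simpa using h)] with v hv
      exact (hq _).2 hv
    · intro y x U V hU hV
      refine hqs (φ x) (φ y) _ _ ?_ ?_
      · change φ U = _
        rw [hU]; simp
      · change φ V = _
        rw [hV]; simp
  let u' : (Matrix (Fin 1) (Fin 1) R)ˣ := Units.map (φ.symm : R →* _) u
  have hu' : (u' : Matrix (Fin 1) (Fin 1) R) = Matrix.of fun _ _ => (u : R) := rfl
  have := Matrix.eq_one_of_joined_fromBlocks hd hQ k u' U (by rw [hU, hu']) hj
  have h2 := (hq _).1 this
  exact h2

end CStar

/-- Vanishing `K₁` and stable rank one make the group of units path connected. -/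
theorem K1Trivial.joinedIn_one {B : Type*} [NonUnitalCStarAlgebra B] (hB : K1Trivial B)
    (hs : StableRankOne B) {x : Unitization ℂ B} (hx : IsUnit x) :
    JoinedIn {z : Unitization ℂ B | IsUnit z} x 1 := by
  obtain ⟨x, rfl⟩ := hx
  obtain ⟨w, hw⟩ := exists_unitary_joinedIn x
  refine hw.trans ?_
  have hmem : (Matrix.of fun _ _ => (w : Unitization ℂ B)) ∈
      unitary (Matrix (Fin 1) (Fin 1) (Unitization ℂ B)) := by
    rw [Unitary.mem_iff]
    constructor
    · refine Matrix.ext fun i j => ?_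
      rw [Subsingleton.elim i 0, Subsingleton.elim j 0]
      simp [Matrix.mul_apply, Matrix.star_apply]
    · refine Matrix.ext fun i j => ?_
      rw [Subsingleton.elim i 0, Subsingleton.elim j 0]
      simp [Matrix.mul_apply, Matrix.star_apply]
  obtain ⟨k, h, hj⟩ := hB 1 one_pos ⟨_, hmem⟩
  let ψ : unitary (Matrix (Fin 1 ⊕ Fin k) (Fin 1 ⊕ Fin k) (Unitization ℂ B)) →*
      (Matrix (Fin 1 ⊕ Fin k) (Fin 1 ⊕ Fin k) (Unitization ℂ B))ˣ := Unitary.toUnits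
  have hψ : Continuous ψ := by
    rw [Matrix.isOpenEmbedding_unitsVal.isEmbedding.continuous_iff]
    exact continuous_subtype_val
  refine joinedIn_one_of_joined_fromBlocks hs (Unitary.toUnits w).isUnit (ψ ⟨_, h⟩) rfl ?_
  have := hj.map hψ
  rwa [map_one] at this

theorem isUnit_unitization_of_coe {A : Type*} [NonUnitalCStarAlgebra A]
    {B : NonUnitalStarSubalgebra ℂ A} (hB : ∀ b ∈ B, ∀ a : A, ∀ b' ∈ B, b * a * b' ∈ B)
    {c : ℂ} {k : B} (h : IsUnit (algebraMap ℂ (Unitization ℂ A) c + (k : A))) :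
    IsUnit (algebraMap ℂ (Unitization ℂ B) c + (k : Unitization ℂ B)) := by
  obtain ⟨u, hu⟩ := h
  set y : Unitization ℂ A := ↑u⁻¹ with hy
  have h1 : (algebraMap ℂ (Unitization ℂ A) c + (k : A)) * y = 1 := by
    rw [← hu]; exact u.mul_inv
  have h2 : y * (algebraMap ℂ (Unitization ℂ A) c + (k : A)) = 1 := by
    rw [← hu]; exact u.inv_mul
  have f1 := congrArg (fun z => z.fst) h1
  have s1 := congrArg (fun z => z.snd) h1
  have s2 := congrArg (fun z => z.snd) h2
  simp [Unitization.algebraMap_eq_inl] at f1 s1 s2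
  have hc : c ≠ 0 := left_ne_zero_of_mul_eq_one f1
  have key : y.snd = -(c⁻¹ • y.fst • (k : A)) - c⁻¹ • (k * y.snd) := by
    have := congrArg (c⁻¹ • ·) s1
    simp only [smul_add, smul_zero, smul_smul, inv_mul_cancel₀ hc, one_smul] at this
    rw [smul_smul, eq_sub_iff_add_eq, eq_neg_iff_add_eq_zero, ← this]
    abel
  have key2 : (k : A) * y.snd ∈ B := by
    have e2 : y.snd = -(c⁻¹ • y.fst • (k : A)) - c⁻¹ • (y.snd * k) := by
      have := congrArg (c⁻¹ • ·) s2
      simp only [smul_add, smul_zero, smul_smul, inv_mul_cancel₀ hc, one_smul] at this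
      rw [smul_smul, eq_sub_iff_add_eq, eq_neg_iff_add_eq_zero, ← this]
      abel
    rw [e2, mul_sub, mul_neg, mul_smul_comm, mul_smul_comm, mul_smul_comm, ← mul_assoc]
    exact sub_mem (neg_mem (B.smul_mem _ (B.smul_mem _ (B.mul_mem k.2 k.2))))
      (B.smul_mem _ (hB _ k.2 _ _ k.2))
  have key3 : y.snd ∈ B := by
    rw [key]
    exact sub_mem (neg_mem (B.smul_mem _ (B.smul_mem _ k.2))) (B.smul_mem _ key2)
  let y' : Unitization ℂ B := algebraMap ℂ _ y.fst + ((⟨y.snd, key3⟩ : B) : Unitization ℂ B)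
  have f2 : y.fst * c = 1 := by rw [mul_comm]; exact f1
  refine isUnit_iff_exists.2 ⟨y', ?_, ?_⟩
  · refine Unitization.ext ?_ (Subtype.ext ?_)
    · simpa [y', Unitization.algebraMap_eq_inl] using f1
    · simpa [y', Unitization.algebraMap_eq_inl] using s1
  · refine Unitization.ext ?_ (Subtype.ext ?_)
    · simpa [y', Unitization.algebraMap_eq_inl] using f2
    · simpa [y', Unitization.algebraMap_eq_inl] using s2

theorem exists_norm_mul_sub_lt {B : Type*} [NonUnitalCStarAlgebra B] (b : B) {ε : ℝ}
    (hε : 0 < ε) : ∃ e : B, ‖e * b - b‖ < ε := by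
  let _ := CStarAlgebra.spectralOrder B
  have := CStarAlgebra.spectralOrderedRing B
  have h := CStarAlgebra.increasingApproximateUnit B
  have := h.neBot
  have h2 := (h.tendsto_mul_right b).eventually (Metric.ball_mem_nhds b hε)
  obtain ⟨e, he⟩ := h2.exists
  exact ⟨e, by simpa [dist_eq_norm] using he⟩

theorem StableRankOne.mem_closure_isUnit {A : Type*} [NonUnitalCStarAlgebra A]
    (hA : StableRankOne A)
    {B : NonUnitalStarSubalgebra ℂ A} [IsClosed (B : Set A)]
    (hB : ∀ b ∈ B, ∀ a : A, ∀ b' ∈ B, b * a * b' ∈ B) (b : B) :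
    b ∈ closure {k : B | IsUnit (1 + ((k : A) : Unitization ℂ A))} := by
  rw [Metric.mem_closure_iff]
  intro ε hε
  obtain ⟨e, he⟩ := exists_norm_mul_sub_lt b (half_pos hε)
  let F : Unitization ℂ A → Unitization ℂ A := fun m => ((e : A) : Unitization ℂ A) *
    Ring.inverse m * ((b : A) : Unitization ℂ A)
  have hF : ContinuousAt F 1 := by
    have : ContinuousAt Ring.inverse (1 : Unitization ℂ A) :=
      NormedRing.inverse_continuousAt 1
    fun_prop
  have h1 : ∀ᶠ m in 𝓝 (1 : Unitization ℂ A), ‖F m - F 1‖ < ε / 2 := by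
    filter_upwards [hF.eventually (Metric.ball_mem_nhds _ (half_pos hε))] with m hm
    simpa [dist_eq_norm] using hm
  have h2 : ∀ᶠ m in 𝓝 (1 : Unitization ℂ A), IsUnit m := Units.nhds 1
  let be : Unitization ℂ A := ((b : A) : Unitization ℂ A) * ((e : A) : Unitization ℂ A)
  have h3 : ∀ᶠ u in 𝓝 (1 + be), ‖F (u - be) - F 1‖ < ε / 2 ∧ IsUnit (u - be) := by
    have : Tendsto (fun u => u - be) (𝓝 (1 + be)) (𝓝 1) := by
      have : Continuous (fun u => u - be) := by fun_prop
      simpa using this.tendsto (1 + be)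
    exact this.eventually (h1.and h2)
  obtain ⟨u, ⟨hu1, ⟨m, hm⟩⟩, hu⟩ := mem_closure_iff_nhds.1 (hA (1 + be)) _ h3
  have hu' : IsUnit u := hu
  rw [← hm] at hu1
  have hFm : F m = ((e : A) : Unitization ℂ A) * ↑m⁻¹ * ((b : A) : Unitization ℂ A) := by
    simp [F]
  have hmem : (F m).snd ∈ B ∧ (F m).fst = 0 := by
    rw [hFm]
    constructor
    · simp only [Unitization.snd_mul, Unitization.fst_mul, Unitization.fst_inr,
        Unitization.snd_inr, zero_mul, zero_smul, zero_add, add_mul, smul_mul_assoc, add_zero]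
      exact add_mem (B.smul_mem _ (B.mul_mem e.2 b.2)) (hB _ e.2 _ _ b.2)
    · simp
  have hk : (((F m).snd : A) : Unitization ℂ A) = F m := by
    refine Unitization.ext ?_ ?_
    · simp [hmem.2]
    · simp
  refine ⟨⟨(F m).snd, hmem.1⟩, ?_, ?_⟩
  · change IsUnit (1 + (((F m).snd : A) : Unitization ℂ A))
    rw [hk, hFm, mul_assoc]
    have : u = m * (1 + ↑m⁻¹ * ((b : A) : Unitization ℂ A) * ((e : A) : Unitization ℂ A)) := by
      rw [mul_add, mul_one, ← mul_assoc, ← mul_assoc, Units.mul_inv, one_mul, hm]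
      exact (sub_add_cancel _ _).symm
    rw [this, Units.isUnit_units_mul] at hu'
    exact isUnit_one_add_mul_swap hu'
  · rw [dist_eq_norm, norm_sub_rev]
    have e1 : ‖(⟨(F m).snd, hmem.1⟩ : B) - b‖ = ‖F m - ((b : A) : Unitization ℂ A)‖ := by
      conv_rhs => rw [← hk, ← Unitization.inr_sub, Unitization.norm_inr]
      rfl
    have e2 : ‖F 1 - ((b : A) : Unitization ℂ A)‖ < ε / 2 := by
      have : F 1 - ((b : A) : Unitization ℂ A) = ((((e * b - b : B)) : A) : Unitization ℂ A) := by
        simp [F]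
      rw [this, Unitization.norm_inr]
      exact he
    rw [e1]
    calc _ = ‖(F m - F 1) + (F 1 - ((b : A) : Unitization ℂ A))‖ := by rw [sub_add_sub_cancel]
      _ < _ := (norm_add_le _ _).trans_lt (by linarith)

/-- Stable rank one passes to hereditary subalgebras. -/
theorem StableRankOne.hereditary {A : Type*} [NonUnitalCStarAlgebra A] (hA : StableRankOne A)
    (B : NonUnitalStarSubalgebra ℂ A) [IsClosed (B : Set A)]
    (hB : ∀ b ∈ B, ∀ a : A, ∀ b' ∈ B, b * a * b' ∈ B) : StableRankOne B := by
  have h1 : ∀ (c : ℂ) (b : B), c ≠ 0 → algebraMap ℂ (Unitization ℂ B) c * (1 + (b : Unitization ℂ B)) ∈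
      closure {x : Unitization ℂ B | IsUnit x} := by
    intro c b hc
    refine map_mem_closure (f := fun b : B => algebraMap ℂ (Unitization ℂ B) c *
      (1 + (b : Unitization ℂ B))) ?_ (hA.mem_closure_isUnit hB b) ?_
    · have : Continuous (fun b : B => (b : Unitization ℂ B)) :=
        (Unitization.isometry_inr (𝕜 := ℂ) (A := B)).continuous
      fun_prop
    · intro k hk
      have := isUnit_unitization_of_coe hB (c := 1) (k := k) (by simpa using hk)
      rw [map_one] at this
      exact ((IsUnit.mk0 c hc).map _).mul this
  intro x
  have h2 : Tendsto (fun c : ℂ => x + algebraMap ℂ (Unitization ℂ B) (c - x.fst)) (𝓝[≠] x.fst) (𝓝 x) := by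
    have : Continuous (fun c : ℂ => x + algebraMap ℂ (Unitization ℂ B) (c - x.fst)) := by
      have := continuous_algebraMap ℂ (Unitization ℂ B)
      fun_prop
    have := this.tendsto x.fst
    simp only [sub_self, map_zero, add_zero] at this
    exact this.mono_left nhdsWithin_le_nhds
  have h3 : ∀ c : ℂ, c ≠ 0 → x + algebraMap ℂ (Unitization ℂ B) (c - x.fst) ∈
      closure {x : Unitization ℂ B | IsUnit x} := by
    intro c hc
    convert h1 c (c⁻¹ • x.snd) hc using 1
    refine Unitization.ext ?_ ?_
    · simp [Unitization.algebraMap_eq_inl, sub_eq_add_neg]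
    · simp [Unitization.algebraMap_eq_inl, hc, sub_eq_add_neg]
  by_cases hx : x.fst = 0
  · refine isClosed_closure.mem_of_tendsto h2 ?_
    filter_upwards [self_mem_nhdsWithin] with c hc
    exact h3 c (by simpa [hx] using hc)
  · simpa using h3 x.fst hx

/-- The continuous piecewise linear function equal to `1` below `α` and `0` above `α + 10`. -/
noncomputable def spectralRamp (α s : ℝ) : ℝ := max 0 (min 1 ((α + 10 - s) / 10))

theorem continuous_spectralRamp (α : ℝ) : Continuous (spectralRamp α) := by
  unfold spectralRamp
  fun_prop

theorem spectralRamp_nonneg (α s : ℝ) : 0 ≤ spectralRamp α s := le_max_left _ _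

theorem spectralRamp_le_one (α s : ℝ) : spectralRamp α s ≤ 1 :=
  max_le zero_le_one (min_le_left _ _)

theorem spectralRamp_eq_one {α s : ℝ} (h : s ≤ α) : spectralRamp α s = 1 := by
  unfold spectralRamp
  rw [min_eq_left (by linarith), max_eq_right zero_le_one]

theorem spectralRamp_eq_zero {α s : ℝ} (h : α + 10 ≤ s) : spectralRamp α s = 0 := by
  unfold spectralRamp
  exact max_eq_left ((min_le_right _ _).trans (by linarith))

theorem spectralRamp_mul (α s : ℝ) :
    spectralRamp α s * spectralRamp (α + 10) s = spectralRamp α s := by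
  rcases le_total s (α + 10) with h | h
  · rw [spectralRamp_eq_one h, mul_one]
  · rw [spectralRamp_eq_zero h, zero_mul]

theorem abs_mul_spectralRamp_le {α s : ℝ} (hα : 0 ≤ α) (hs : 0 ≤ s) :
    |s * spectralRamp α s| ≤ α + 10 := by
  rw [abs_of_nonneg (mul_nonneg hs (spectralRamp_nonneg _ _))]
  rcases le_total s (α + 10) with h | h
  · exact (mul_le_of_le_one_right hs (spectralRamp_le_one _ _)).trans h
  · rw [spectralRamp_eq_zero h, mul_zero]; linarith

section Cfc

variable {R : Type*} [CStarAlgebra R] [PartialOrder R] [StarOrderedRing R]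

theorem norm_cfc_spectralRamp_le (p : R) (α : ℝ) : ‖cfc (spectralRamp α) p‖ ≤ 1 :=
  norm_cfc_le zero_le_one fun s _ => by
    rw [Real.norm_of_nonneg (spectralRamp_nonneg _ _)]; exact spectralRamp_le_one _ _

theorem isSelfAdjoint_cfc_spectralRamp (p : R) (α : ℝ) :
    IsSelfAdjoint (cfc (spectralRamp α) p) := cfc_predicate _ _

theorem cfc_spectralRamp_mul (p : R) (α : ℝ) :
    cfc (spectralRamp α) p * cfc (spectralRamp (α + 10)) p = cfc (spectralRamp α) p := by
  rw [← cfc_mul _ _ _ (continuous_spectralRamp _).continuousOn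
    (continuous_spectralRamp _).continuousOn]
  simp only [spectralRamp_mul]

theorem cfc_spectralRamp_mul' (p : R) (α : ℝ) :
    cfc (spectralRamp (α + 10)) p * cfc (spectralRamp α) p = cfc (spectralRamp α) p := by
  rw [← (cfc_commute_cfc (spectralRamp α) (spectralRamp (α + 10)) p).eq, cfc_spectralRamp_mul]

theorem norm_mul_cfc_spectralRamp_le {p : R} (hp : 0 ≤ p) {α : ℝ} (hα : 0 ≤ α) :
    ‖p * cfc (spectralRamp α) p‖ ≤ α + 10 := by
  have hsa := hp.isSelfAdjoint
  nth_rw 1 [← cfc_id ℝ p]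
  rw [← cfc_mul _ _ _ continuousOn_id (continuous_spectralRamp _).continuousOn]
  exact norm_cfc_le (by linarith) fun s hs =>
    abs_mul_spectralRamp_le hα (spectrum_nonneg_of_nonneg hp hs)

theorem exists_unit_add_smul_cfc_spectralRamp {p : R} (hp : 0 ≤ p) :
    ∃ u : Rˣ, (u : R) = p + (20 : ℝ) • cfc (spectralRamp 20) p ∧
      ‖((u⁻¹ : Rˣ) : R)‖ ≤ 1 / 20 := by
  have hsa := hp.isSelfAdjoint
  have hc := continuous_spectralRamp 20
  have hge : ∀ s ∈ spectrum ℝ p, 20 ≤ s + 20 * spectralRamp 20 s := by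
    intro s hs
    have hs0 : 0 ≤ s := spectrum_nonneg_of_nonneg hp hs
    have := spectralRamp_nonneg 20 s
    rcases le_total s 20 with h | h
    · rw [spectralRamp_eq_one h]; linarith
    · linarith
  have e : p + (20 : ℝ) • cfc (spectralRamp 20) p = cfc (fun s => s + 20 * spectralRamp 20 s) p := by
    rw [cfc_add (a := p) (fun s => s) (fun s => 20 * spectralRamp 20 s), cfc_id' ℝ p,
      cfc_const_mul 20 (spectralRamp 20) p hc.continuousOn]
  have hcf : ContinuousOn (fun s : ℝ => s + 20 * spectralRamp 20 s) (spectrum ℝ p) := by fun_prop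
  have hci : ContinuousOn (fun s : ℝ => (s + 20 * spectralRamp 20 s)⁻¹) (spectrum ℝ p) :=
    hcf.inv₀ fun s hs => (by linarith [hge s hs] : (0 : ℝ) < _).ne'
  have h1 : cfc (fun s => s + 20 * spectralRamp 20 s) p *
      cfc (fun s => (s + 20 * spectralRamp 20 s)⁻¹) p = 1 := by
    rw [← cfc_mul _ _ _ hcf hci, ← cfc_one ℝ p]
    exact cfc_congr fun s hs => mul_inv_cancel₀ (by linarith [hge s hs] : (0 : ℝ) < _).ne'
  refine ⟨⟨_, _, h1, ?_⟩, e.symm, ?_⟩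
  · rw [(cfc_commute_cfc _ _ p).eq, h1]
  · refine norm_cfc_le (by norm_num) fun s hs => ?_
    have := hge s hs
    rw [norm_inv, Real.norm_of_nonneg (by linarith), one_div]
    exact inv_anti₀ (by norm_num) this

end Cfc

theorem fst_cfc_spectralRamp {A : Type*} [NonUnitalCStarAlgebra A]
    {p : Unitization ℂ A} (hp : IsSelfAdjoint p) {c α : ℝ} (hc : p.fst = (c : ℂ)) (h : α + 10 ≤ c) :
    (cfc (spectralRamp α) p).fst = 0 := by
  let φ : Unitization ℂ A →⋆ₐ[ℂ] ℂ :=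
    { Unitization.fstHom ℂ A with map_star' := fun x => by simp }
  have hφ : Continuous φ := by
    exact map_continuous φ
  have := StarAlgHomClass.map_cfc (R := ℝ) (S := ℂ) φ (spectralRamp α) p
    (continuous_spectralRamp _).continuousOn hφ hp (hp.map φ)
  change φ (cfc (spectralRamp α) p) = 0
  rw [this]
  have e : φ p = algebraMap ℝ ℂ c := hc
  rw [e, cfc_algebraMap, spectralRamp_eq_zero h, map_zero]

section Segment

theorem joinedIn_isUnit_inter_of_segment {R : Type*} [NormedRing R] [NormedAlgebra ℝ R]
    {C : Set R} (hC : Convex ℝ C) {x y : R} (hx : x ∈ C) (hy : y ∈ C)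
    (hu : ∀ t : ℝ, 0 ≤ t → t ≤ 1 → IsUnit ((1 - t) • x + t • y)) :
    JoinedIn ({z : R | IsUnit z} ∩ C) x y := by
  refine JoinedIn.ofLine (f := fun t : ℝ => (1 - t) • x + t • y) (by fun_prop)
    (by simp) (by simp) ?_
  rintro _ ⟨t, ht, rfl⟩
  exact ⟨hu t ht.1 ht.2, hC hx hy (by linarith [ht.2]) ht.1 (by ring)⟩

end Segment

/-- The hereditary subalgebra of the elements on which `h` acts as a two-sided unit. -/
def NonUnitalStarSubalgebra.ofLocalUnit {A : Type*} [NonUnitalCStarAlgebra A] (h : A)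
    (hh : IsSelfAdjoint h) : NonUnitalStarSubalgebra ℂ A where
  carrier := {x | h * x = x ∧ x * h = x}
  add_mem' := fun {a b} ha hb => ⟨by rw [mul_add, ha.1, hb.1], by rw [add_mul, ha.2, hb.2]⟩
  zero_mem' := ⟨mul_zero _, zero_mul _⟩
  mul_mem' := fun {a b} ha hb => ⟨by rw [← mul_assoc, ha.1], by rw [mul_assoc, hb.2]⟩
  smul_mem' := fun c a ha => ⟨by rw [mul_smul_comm, ha.1], by rw [smul_mul_assoc, ha.2]⟩
  star_mem' := fun {a} ha => ⟨by
    have := congrArg star ha.2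
    rwa [star_mul, hh.star_eq] at this, by
    have := congrArg star ha.1
    rwa [star_mul, hh.star_eq] at this⟩

theorem NoK1Obstructions.joinedIn_of_localUnit {A : Type*} [NonUnitalCStarAlgebra A]
    (hA : NoK1Obstructions A) {h k : A} (hh : IsSelfAdjoint h) (h1 : h * k = k) (h2 : k * h = k)
    (hu : IsUnit (1 - (k : Unitization ℂ A))) :
    JoinedIn {x : A | (h * x = x ∧ x * h = x) ∧ IsUnit (1 - (x : Unitization ℂ A))} k 0 := by
  let B := NonUnitalStarSubalgebra.ofLocalUnit h hh
  have hmem : ∀ x, x ∈ B ↔ h * x = x ∧ x * h = x := fun x => Iff.rfl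
  have hcl : IsClosed (B : Set A) :=
    (isClosed_eq (by fun_prop) continuous_id).inter (isClosed_eq (by fun_prop) continuous_id)
  have hher : ∀ b ∈ B, ∀ a : A, ∀ b' ∈ B, b * a * b' ∈ B := by
    intro b hb a b' hb'
    rw [hmem] at hb hb' ⊢
    exact ⟨by rw [← mul_assoc, ← mul_assoc, hb.1], by rw [mul_assoc, hb'.2]⟩
  let k' : B := ⟨k, h1, h2⟩
  have hx : IsUnit (1 + ((-k' : B) : Unitization ℂ B)) := by
    have := isUnit_unitization_of_coe hher (c := 1) (k := -k') (by
      simpa [k', sub_eq_add_neg] using hu)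
    simpa using this
  have hj := K1Trivial.joinedIn_one (hA.2 B hher) (hA.1.hereditary B hher) hx
  let f : Unitization ℂ B → A := fun z => -(z.fst⁻¹ • (z.snd : A))
  have hne : ∀ z : Unitization ℂ B, IsUnit z → z.fst ≠ 0 := fun z hz =>
    (hz.map (Unitization.fstHom ℂ B)).ne_zero
  have hf : ContinuousOn f {z | IsUnit z} := by
    have c1 : Continuous fun z : Unitization ℂ B => z.fst := Unitization.continuous_fst
    have c2 : Continuous fun z : Unitization ℂ B => z.snd := Unitization.continuous_snd
    have c3 : ContinuousOn (fun z : Unitization ℂ B => z.fst⁻¹) {z | IsUnit z} :=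
      c1.continuousOn.inv₀ fun z hz => hne z hz
    exact (c3.smul (continuous_subtype_val.comp c2).continuousOn).neg
  have hj' := JoinedIn.map_continuousOn hj (f := f) hf
  have e1 : f (1 + ((-k' : B) : Unitization ℂ B)) = k := by simp [f, k']
  have e2 : f 1 = 0 := by simp [f]
  rw [e1, e2] at hj'
  refine hj'.mono ?_
  rintro _ ⟨z, hz, rfl⟩
  refine ⟨(hmem _).1 (neg_mem (SMulMemClass.smul_mem _ z.snd.2)), ?_⟩
  have := (hz.map (Unitization.starMap (NonUnitalStarSubalgebraClass.subtype B)))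
  have e3 : 1 - ((f z : A) : Unitization ℂ A) = algebraMap ℂ _ z.fst⁻¹ *
      Unitization.starMap (NonUnitalStarSubalgebraClass.subtype B) z := by
    have hz0 := hne z hz
    have : z = algebraMap ℂ _ z.fst + (z.snd : Unitization ℂ B) := by
      refine Unitization.ext ?_ ?_ <;> simp [Unitization.algebraMap_eq_inl]
    conv_rhs => rw [this]
    rw [map_add, Unitization.starMap_inr, AlgHomClass.commutes]
    refine Unitization.ext ?_ ?_ <;> simp [Unitization.algebraMap_eq_inl, f, hz0, sub_eq_add_neg]
  rw [e3]
  exact ((IsUnit.mk0 _ (inv_ne_zero (hne z hz))).map (algebraMap ℂ (Unitization ℂ A))).mul this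

theorem NoK1Obstructions.joinedIn_unit_of_localUnits {A : Type*} [NonUnitalCStarAlgebra A]
    (hA : NoK1Obstructions A) {a₁ a₂ a₃ : A} {p b z : Unitization ℂ A} (m : (Unitization ℂ A)ˣ)
    (hsa : IsSelfAdjoint a₃) (h12 : a₁ * a₂ = a₁) (h23 : a₂ * a₃ = a₂) (h32 : a₃ * a₂ = a₂)
    (hn₁ : ‖a₁‖ ≤ 1) (hn₃ : ‖a₃‖ ≤ 1)
    (hm : ‖(m : Unitization ℂ A) - p‖ ≤ 21) (hm₂ : ‖(m : Unitization ℂ A) * a₂‖ ≤ 71)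
    (hm₃ : ‖(m : Unitization ℂ A) * a₃‖ ≤ 71) (hz : ‖z‖ ≤ 2) (hb : b = m * (1 - z * a₁))
    (hbu : IsUnit b) (hbp : ‖b - p‖ < 400) :
    JoinedIn ({x | IsUnit x} ∩ Metric.ball p 400) b m := by
  set M : Unitization ℂ A := (m : Unitization ℂ A) with hM
  set H₁ : Unitization ℂ A := (a₁ : Unitization ℂ A) with hH₁
  set H₂ : Unitization ℂ A := (a₂ : Unitization ℂ A) with hH₂
  set H₃ : Unitization ℂ A := (a₃ : Unitization ℂ A) with hH₃
  have H12 : H₁ * H₂ = H₁ := by rw [hH₁, hH₂, ← Unitization.inr_mul, h12]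
  have H23 : H₂ * H₃ = H₂ := by rw [hH₂, hH₃, ← Unitization.inr_mul, h23]
  have H32 : H₃ * H₂ = H₂ := by rw [hH₂, hH₃, ← Unitization.inr_mul, h32]
  have H13 : H₁ * H₃ = H₁ := by rw [← H12, mul_assoc, H23]
  have hN₁ : ‖H₁‖ ≤ 1 := by rwa [hH₁, Unitization.norm_inr]
  have hN₃ : ‖H₃‖ ≤ 1 := by rwa [hH₃, Unitization.norm_inr]
  have hball : Convex ℝ (Metric.ball p 400) := convex_ball p 400
  have hmu : ∀ x, IsUnit (M * x) ↔ IsUnit x := fun x => Units.isUnit_units_mul m x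
  -- the corner element
  set k : Unitization ℂ A := H₂ * (z * H₁) with hk
  have hkA : ((k.snd : A) : Unitization ℂ A) = k := by
    refine Unitization.ext ?_ ?_
    · simp [hk, hH₁]
    · simp
  have k3 : H₃ * k = k := by rw [hk, ← mul_assoc, H32]
  have k3' : k * H₃ = k := by rw [hk, mul_assoc, mul_assoc, H13]
  have hMk : ‖M * k‖ ≤ 142 := by
    rw [hk, ← mul_assoc]
    calc _ ≤ ‖M * H₂‖ * (‖z‖ * ‖H₁‖) :=
          (norm_mul_le _ _).trans (mul_le_mul_of_nonneg_left (norm_mul_le _ _) (norm_nonneg _))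
      _ ≤ 71 * (2 * 1) := by gcongr
      _ = 142 := by norm_num
  have hk1 : IsUnit (1 - k) := by
    rw [hb, hmu] at hbu
    have := isUnit_one_add_mul_swap (a := -(z * H₁)) (b := H₂) (by
      rw [neg_mul, mul_assoc, H12, ← sub_eq_add_neg]; exact hbu)
    rwa [mul_neg, ← sub_eq_add_neg] at this
  have mem_ball : ∀ y : Unitization ℂ A, ‖y - M‖ ≤ 378 → y ∈ Metric.ball p 400 := by
    intro y hy
    rw [mem_ball_iff_norm]
    calc ‖y - p‖ = ‖(y - M) + (M - p)‖ := by rw [sub_add_sub_cancel]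
      _ ≤ 378 + 21 := (norm_add_le _ _).trans (add_le_add hy hm)
      _ < 400 := by norm_num
  have hbm : b ∈ Metric.ball p 400 := by rwa [mem_ball_iff_norm]
  have hm1 : M * (1 - k) ∈ Metric.ball p 400 := mem_ball _ (by
    rw [mul_sub, mul_one, sub_sub_cancel_left, norm_neg]; linarith)
  have hcut : JoinedIn ({x | IsUnit x} ∩ Metric.ball p 400) b (M * (1 - k)) := by
    refine joinedIn_isUnit_inter_of_segment hball hbm hm1 fun t _ _ => ?_
    have e : (1 - t) • b + t • (M * (1 - k)) =
        M * (1 + ((1 - t) • 1 + t • H₂) * (-(z * H₁))) := by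
      rw [hb, hk]
      simp only [mul_sub, mul_add, add_mul, smul_mul_assoc, mul_one, one_mul, mul_neg, smul_sub,
        mul_smul_comm]
      module
    rw [e, hmu]
    refine isUnit_one_add_mul_swap ?_
    have e2 : -(z * H₁) * ((1 - t) • 1 + t • H₂) = -(z * H₁) := by
      rw [mul_add, mul_smul_comm, mul_smul_comm, mul_one, neg_mul, mul_assoc, H12]
      module
    rw [e2, ← sub_eq_add_neg, ← hmu, ← hb]
    exact hbu
  have hsmall : ∀ s : ℝ, 0 ≤ s → s < 1 → IsUnit (1 - s • H₃) := by
    intro s h0 h1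
    refine isUnit_one_sub_of_norm_lt_one ?_
    rw [norm_smul, Real.norm_of_nonneg h0]
    nlinarith [norm_nonneg H₃]
  obtain ⟨γ, hγ⟩ := hA.joinedIn_of_localUnit hsa (k := k.snd)
    (by apply Unitization.inr_injective (R := ℂ); rw [Unitization.inr_mul, hkA]; exact k3)
    (by apply Unitization.inr_injective (R := ℂ); rw [Unitization.inr_mul, hkA]; exact k3')
    (by rw [hkA]; exact hk1)
  obtain ⟨c, hc⟩ : ∃ c : ℝ, ∀ t, ‖γ t‖ ≤ c := by
    obtain ⟨c, hc⟩ := (isCompact_range γ.continuous).isBounded.exists_norm_le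
    exact ⟨c, fun t => hc _ ⟨t, rfl⟩⟩
  have hc0 : 0 ≤ c := (norm_nonneg _).trans (hc 0)
  set η : ℝ := 1 / (71 * c + 1) with hη
  have hη0 : 0 < η := by positivity
  have hη1 : η ≤ 1 := by
    rw [hη, div_le_one (by positivity)]; linarith
  have hηc : η * (71 * c) ≤ 1 := by
    rw [hη, div_mul_eq_mul_div, div_le_one (by positivity)]; linarith
  have e3 : ∀ x : Unitization ℂ A, H₃ * x = x → (1 - (1 - η) • H₃) * (1 - x) = 1 - (1 - η) • H₃ - η • x := by
    intro x hx
    rw [mul_sub, mul_one, sub_mul, one_mul, smul_mul_assoc, hx]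
    module
  have hγ3 : ∀ t, H₃ * (γ t : Unitization ℂ A) = γ t := fun t => by
    rw [hH₃, ← Unitization.inr_mul, (hγ t).1.1]
  have hMH : ‖(1 - η) • (M * H₃)‖ ≤ 71 := by
    rw [norm_smul, Real.norm_of_nonneg (by linarith)]
    nlinarith [norm_nonneg (M * H₃)]
  have hmem3 : ∀ t, M * ((1 - (1 - η) • H₃) * (1 - (γ t : Unitization ℂ A))) ∈
      ({x | IsUnit x} ∩ Metric.ball p 400 : Set (Unitization ℂ A)) := by
    intro t
    refine ⟨(hmu _).2 ((hsmall _ (by linarith) (by linarith)).mul (hγ t).2), mem_ball _ ?_⟩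
    have e : M * ((1 - (1 - η) • H₃) * (1 - (γ t : Unitization ℂ A))) - M =
        -((1 - η) • (M * H₃)) - η • (M * H₃ * γ t) := by
      rw [e3 _ (hγ3 t), mul_assoc, hγ3 t]
      simp only [mul_sub, mul_one, mul_smul_comm]
      module
    rw [e]
    refine (norm_sub_le _ _).trans ?_
    rw [norm_neg, norm_smul η, Real.norm_of_nonneg hη0.le]
    have h4 : ‖M * H₃ * (γ t : Unitization ℂ A)‖ ≤ 71 * c := by
      refine (norm_mul_le _ _).trans ?_
      rw [Unitization.norm_inr]
      exact mul_le_mul hm₃ (hc t) (norm_nonneg _) (by norm_num)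
    have := mul_le_mul_of_nonneg_left h4 hη0.le
    linarith
  have hg0 : ((γ 0 : A) : Unitization ℂ A) = k := by rw [γ.source, hkA]
  have hg1 : ((γ 1 : A) : Unitization ℂ A) = 0 := by rw [γ.target, Unitization.inr_zero]
  have hrotate : JoinedIn ({x | IsUnit x} ∩ Metric.ball p 400)
      (M * ((1 - (1 - η) • H₃) * (1 - k))) (M * (1 - (1 - η) • H₃)) := by
    refine ⟨⟨⟨fun t => M * ((1 - (1 - η) • H₃) * (1 - (γ t : Unitization ℂ A))), ?_⟩, ?_, ?_⟩, hmem3⟩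
    · have : Continuous fun x : A => (x : Unitization ℂ A) :=
        (Unitization.isometry_inr (𝕜 := ℂ) (A := A)).continuous
      have h := this.comp γ.continuous
      exact continuous_const.mul (continuous_const.mul (continuous_const.sub h))
    · change M * ((1 - (1 - η) • H₃) * (1 - ((γ 0 : A) : Unitization ℂ A))) = _
      rw [hg0]
    · change M * ((1 - (1 - η) • H₃) * (1 - ((γ 1 : A) : Unitization ℂ A))) = _
      rw [hg1, sub_zero, mul_one]
  have hcorner : JoinedIn ({x | IsUnit x} ∩ Metric.ball p 400)
      (M * (1 - k)) (M * ((1 - (1 - η) • H₃) * (1 - k))) := by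
    refine joinedIn_isUnit_inter_of_segment hball hm1 hrotate.source_mem.2 fun t h0 h1 => ?_
    have e : (1 - t) • (M * (1 - k)) + t • (M * ((1 - (1 - η) • H₃) * (1 - k))) =
        M * ((1 - (t * (1 - η)) • H₃) * (1 - k)) := by
      simp only [mul_sub, sub_mul, smul_mul_assoc, mul_one, one_mul, smul_sub, mul_smul_comm]
      module
    rw [e, hmu]
    exact (hsmall _ (mul_nonneg h0 (by linarith)) (by nlinarith)).mul hk1
  have hrestore : JoinedIn ({x | IsUnit x} ∩ Metric.ball p 400)
      (M * (1 - (1 - η) • H₃)) M := by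
    refine joinedIn_isUnit_inter_of_segment hball hrotate.target_mem.2
      (mem_ball _ (by simp)) fun t h0 h1 => ?_
    have e : (1 - t) • (M * (1 - (1 - η) • H₃)) + t • M =
        M * (1 - ((1 - t) * (1 - η)) • H₃) := by
      simp only [mul_sub, mul_one, smul_sub, mul_smul_comm]
      module
    rw [e, hmu]
    exact hsmall _ (mul_nonneg (by linarith) (by linarith)) (by nlinarith)
  exact ((hcut.trans hcorner).trans hrotate).trans hrestore

theorem NoK1Obstructions.joinedIn_of_isStrictlyPositive {A : Type*} [NonUnitalCStarAlgebra A]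
    [PartialOrder (Unitization ℂ A)] [StarOrderedRing (Unitization ℂ A)]
    (hA : NoK1Obstructions A) {p b : Unitization ℂ A} (hp : IsStrictlyPositive p) {c : ℝ}
    (hc : p.fst = (c : ℂ)) (hc50 : 50 ≤ c) (hb : IsUnit b) (hbp : ‖b - p‖ < 1) :
    JoinedIn ({x | IsUnit x} ∩ Metric.ball p 400) b p := by
  have hp0 := hp.nonneg
  have hsa := hp0.isSelfAdjoint
  set h := fun α : ℝ => cfc (spectralRamp α) p with hh
  have hcoe : ∀ α : ℝ, α + 10 ≤ c → (((h α).snd : A) : Unitization ℂ A) = h α := by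
    intro α hα
    refine Unitization.ext ?_ ?_
    · simp [hh, fst_cfc_spectralRamp hsa hc hα]
    · simp
  have e1 := hcoe 20 (by linarith)
  have e2 := hcoe 30 (by linarith)
  have e3 := hcoe 40 (by linarith)
  have inj := Unitization.inr_injective (R := ℂ) (A := A)
  have m12 : h 20 * h 30 = h 20 := by
    have := cfc_spectralRamp_mul p 20
    norm_num at this; exact this
  have m23 : h 30 * h 40 = h 30 := by
    have := cfc_spectralRamp_mul p 30
    norm_num at this; exact this
  have m32 : h 40 * h 30 = h 30 := by
    have := cfc_spectralRamp_mul' p 30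
    norm_num at this; exact this
  have m13 : h 20 * h 40 = h 20 := by rw [← m12, mul_assoc, m23]
  obtain ⟨P, hP, hPi⟩ := exists_unit_add_smul_cfc_spectralRamp hp0
  change (P : Unitization ℂ A) = p + (20 : ℝ) • h 20 at hP
  have hn : ∀ α, ‖h α‖ ≤ 1 := fun α => norm_cfc_spectralRamp_le p α
  set σ := b - p with hσ
  have hPσ : ‖((P⁻¹ : (Unitization ℂ A)ˣ) : Unitization ℂ A) * σ‖ < 1 / 20 := by
    refine (norm_mul_le _ _).trans_lt ?_
    nlinarith [norm_nonneg σ, norm_nonneg ((P⁻¹ : (Unitization ℂ A)ˣ) : Unitization ℂ A)]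
  have hPt : ∀ t : ℝ, 0 ≤ t → t ≤ 1 → IsUnit ((P : Unitization ℂ A) + t • σ) := by
    intro t h0 h1
    have : (P : Unitization ℂ A) + t • σ =
        P * (1 - (-(t • (((P⁻¹ : (Unitization ℂ A)ˣ) : Unitization ℂ A) * σ)))) := by
      rw [sub_neg_eq_add, mul_add, mul_one, mul_smul_comm, ← mul_assoc, Units.mul_inv, one_mul]
    rw [this, Units.isUnit_units_mul]
    refine isUnit_one_sub_of_norm_lt_one ?_
    rw [norm_neg, norm_smul, Real.norm_of_nonneg h0]
    nlinarith [norm_nonneg (((P⁻¹ : (Unitization ℂ A)ˣ) : Unitization ℂ A) * σ)]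
  obtain ⟨m, hm⟩ := hPt 1 zero_le_one le_rfl
  rw [one_smul] at hm
  have hmb : (m : Unitization ℂ A) = b + (20 : ℝ) • h 20 := by
    rw [hm, hP, hσ]; abel
  have hmp : (m : Unitization ℂ A) - p = (20 : ℝ) • h 20 + σ := by
    rw [hm, hP]; abel
  have hmi : ‖((m⁻¹ : (Unitization ℂ A)ˣ) : Unitization ℂ A)‖ ≤ 1 / 10 := by
    set mi := ((m⁻¹ : (Unitization ℂ A)ˣ) : Unitization ℂ A)
    set Pi := ((P⁻¹ : (Unitization ℂ A)ˣ) : Unitization ℂ A)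
    have : mi = Pi - Pi * σ * mi := by
      have h1 : Pi * (m : Unitization ℂ A) * mi = Pi := by
        rw [mul_assoc, Units.mul_inv, mul_one]
      have h2 : Pi * (m : Unitization ℂ A) = 1 + Pi * σ := by
        rw [hm, mul_add, Units.inv_mul]
      rw [h2, add_mul, one_mul] at h1
      exact eq_sub_of_add_eq h1
    have h3 : ‖mi‖ ≤ 1 / 20 + 1 / 20 * ‖mi‖ := by
      calc ‖mi‖ = ‖Pi - Pi * σ * mi‖ := congrArg _ this
        _ ≤ ‖Pi‖ + ‖Pi * σ‖ * ‖mi‖ := (norm_sub_le _ _).trans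
            (add_le_add_right (norm_mul_le _ _) _)
        _ ≤ _ := by gcongr
    linarith
  have h20 : ‖(20 : ℝ) • h 20‖ ≤ 20 := by
    rw [norm_smul, Real.norm_of_nonneg (by norm_num)]
    linarith [hn 20]
  have hmh : ∀ α : ℝ, 0 ≤ α → α ≤ 40 → h 20 * h α = h 20 → ‖(m : Unitization ℂ A) * h α‖ ≤ 71 := by
    intro α h0 h1 h2
    have e : (m : Unitization ℂ A) * h α = p * h α + (20 : ℝ) • h 20 + σ * h α := by
      rw [hm, hP, add_mul, add_mul, smul_mul_assoc, h2]
    rw [e]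
    have h5 := norm_add₃_le (a := p * h α) (b := (20 : ℝ) • h 20) (c := σ * h α)
    have h6 : ‖p * h α‖ ≤ α + 10 := norm_mul_cfc_spectralRamp_le hp0 h0
    have h7 : ‖σ * h α‖ ≤ 1 := (norm_mul_le _ _).trans (by
      nlinarith [norm_nonneg σ, norm_nonneg (h α), hn α])
    linarith
  have hstart : JoinedIn ({x | IsUnit x} ∩ Metric.ball p 400) b m := by
    refine hA.joinedIn_unit_of_localUnits (a₁ := (h 20).snd) (a₂ := (h 30).snd)
      (a₃ := (h 40).snd) (z := (20 : ℝ) • ((m⁻¹ : (Unitization ℂ A)ˣ) : Unitization ℂ A))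
      m ?_ ?_ ?_ ?_ ?_ ?_ ?_ ?_ ?_ ?_ ?_ hb (hbp.trans (by norm_num))
    · apply inj
      rw [Unitization.inr_star, e3]
      exact isSelfAdjoint_cfc_spectralRamp p 40
    · apply inj; rw [Unitization.inr_mul, e1, e2, m12]
    · apply inj; rw [Unitization.inr_mul, e2, e3, m23]
    · apply inj; rw [Unitization.inr_mul, e2, e3, m32]
    · rw [← Unitization.norm_inr (𝕜 := ℂ), e1]; exact hn _
    · rw [← Unitization.norm_inr (𝕜 := ℂ), e3]; exact hn _
    · rw [hmp]; exact (norm_add_le _ _).trans (by linarith)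
    · rw [e2]; exact hmh 30 (by norm_num) (by norm_num) m12
    · rw [e3]; exact hmh 40 (by norm_num) (by norm_num) m13
    · rw [norm_smul, Real.norm_of_nonneg (by norm_num)]; linarith
    · rw [e1, mul_sub, mul_one, smul_mul_assoc, mul_smul_comm, ← mul_assoc, Units.mul_inv,
        one_mul, hmb, add_sub_cancel_right]
  have hball : Convex ℝ (Metric.ball p 400) := convex_ball p 400
  have hPball : (P : Unitization ℂ A) ∈ Metric.ball p 400 := by
    rw [mem_ball_iff_norm, hP, add_sub_cancel_left]; linarith
  have hmiddle : JoinedIn ({x | IsUnit x} ∩ Metric.ball p 400) (m : Unitization ℂ A) P := by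
    refine joinedIn_isUnit_inter_of_segment hball hstart.target_mem.2 hPball fun t h0 h1 => ?_
    have e : (1 - t) • (m : Unitization ℂ A) + t • (P : Unitization ℂ A) =
        P + (1 - t) • σ := by
      rw [hm]; module
    rw [e]
    exact hPt (1 - t) (by linarith) (by linarith)
  have hend : JoinedIn ({x | IsUnit x} ∩ Metric.ball p 400) (P : Unitization ℂ A) p := by
    refine joinedIn_isUnit_inter_of_segment hball hPball
      (Metric.mem_ball_self (by norm_num)) fun t h0 h1 => ?_
    have e : (1 - t) • (P : Unitization ℂ A) + t • p = p + ((1 - t) * 20) • h 20 := by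
      rw [hP]; module
    rw [e]
    have h2 : 0 ≤ h 20 := cfc_nonneg fun s _ => spectralRamp_nonneg _ _
    exact (hp.add_nonneg (smul_nonneg (by linarith) h2)).isUnit
  exact (hstart.trans hmiddle).trans hend

/-- Nearby units whose scalar part is large compared to their distance are connected by a short
path of units. -/
theorem NoK1Obstructions.joinedIn_ball {A : Type*} [NonUnitalCStarAlgebra A]
    (hA : NoK1Obstructions A) {a b : Unitization ℂ A} (ha : IsUnit a) (hb : IsUnit b) {ε : ℝ}
    (hε : 0 < ε) (hab : ‖a - b‖ < ε) (hfst : 50 * ε ≤ ‖a.fst‖) :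
    JoinedIn ({x | IsUnit x} ∩ Metric.ball a (400 * ε)) a b := by
  let _ := CStarAlgebra.spectralOrder (Unitization ℂ A)
  have := CStarAlgebra.spectralOrderedRing (Unitization ℂ A)
  obtain ⟨v, rfl⟩ := ha
  obtain ⟨w, p, hp, hpp, hv⟩ := exists_unitary_mul_abs v
  have hw1 : star (w : Unitization ℂ A) * w = 1 := Unitary.coe_star_mul_self w
  have hw2 : (w : Unitization ℂ A) * star (w : Unitization ℂ A) = 1 := Unitary.coe_mul_star_self w
  obtain ⟨c, hc0, hc⟩ : ∃ c : ℝ, 0 ≤ c ∧ p.fst = (c : ℂ) := by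
    have hq : IsSelfAdjoint (CFC.sqrt p) := (CFC.sqrt_nonneg p).isSelfAdjoint
    have h2 := CFC.sqrt_mul_sqrt_self p hp.nonneg
    have h3 : star (CFC.sqrt p).fst = (CFC.sqrt p).fst := by
      rw [← Unitization.fst_star, hq.star_eq]
    have h4 := congrArg (fun x => x.fst) h2
    simp only [Unitization.fst_mul] at h4
    obtain ⟨r, hr⟩ := Complex.conj_eq_iff_real.1 h3
    refine ⟨r * r, mul_self_nonneg r, ?_⟩
    rw [← h4, hr]; push_cast; rfl
  have hcv : c = ‖(v : Unitization ℂ A).fst‖ := by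
    have h4 := congrArg (fun x => x.fst) hpp
    simp only [Unitization.fst_mul, Unitization.fst_star, hc] at h4
    have h5 := congrArg norm h4
    rw [norm_mul, norm_mul, norm_star, Complex.norm_real, Real.norm_of_nonneg hc0] at h5
    nlinarith [norm_nonneg (v : Unitization ℂ A).fst]
  have hε' : (0 : ℝ) < ε⁻¹ := inv_pos.2 hε
  have hunit : ∀ r : ℝ, r ≠ 0 → IsUnit (algebraMap ℝ (Unitization ℂ A) r) := fun r hr =>
    (IsUnit.mk0 r hr).map _
  have hP : IsStrictlyPositive (ε⁻¹ • p) := by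
    refine IsUnit.isStrictlyPositive ?_ (smul_nonneg hε'.le hp.nonneg)
    rw [Algebra.smul_def]
    exact (hunit _ hε'.ne').mul hp.isUnit
  have hwu : IsUnit (star (w : Unitization ℂ A)) := ⟨⟨_, _, hw1, hw2⟩, rfl⟩
  have hb' : IsUnit (ε⁻¹ • (star (w : Unitization ℂ A) * b)) := by
    rw [Algebra.smul_def]
    exact (hunit _ hε'.ne').mul (hwu.mul hb)
  have hPa : (w : Unitization ℂ A) * p = v := hv.symm
  have hnw : ∀ x : Unitization ℂ A, ‖star (w : Unitization ℂ A) * x‖ = ‖x‖ := fun x =>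
    CStarRing.norm_coe_unitary_mul (star w) x
  have hnw' : ∀ x : Unitization ℂ A, ‖(w : Unitization ℂ A) * x‖ = ‖x‖ := fun x =>
    CStarRing.norm_coe_unitary_mul w x
  have hpv : p = star (w : Unitization ℂ A) * v := by rw [← hPa, ← mul_assoc, hw1, one_mul]
  have hclose : ‖ε⁻¹ • (star (w : Unitization ℂ A) * b) - ε⁻¹ • p‖ < 1 := by
    rw [← smul_sub, hpv, ← mul_sub, norm_smul, hnw, norm_sub_rev, Real.norm_of_nonneg hε'.le,
      inv_mul_lt_iff₀ hε, mul_one]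
    exact hab
  have hj := hA.joinedIn_of_isStrictlyPositive hP (c := ε⁻¹ * c)
    (by simp [hc]) (by rw [hcv, le_inv_mul_iff₀ hε]; linarith) hb' hclose
  have hj2 := hj.symm.map (f := fun x => ε • ((w : Unitization ℂ A) * x)) (by fun_prop)
  have e1 : ε • ((w : Unitization ℂ A) * (ε⁻¹ • p)) = v := by
    rw [mul_smul_comm, smul_smul, mul_inv_cancel₀ hε.ne', one_smul, hPa]
  have e2 : ε • ((w : Unitization ℂ A) * (ε⁻¹ • (star (w : Unitization ℂ A) * b))) = b := by
    rw [mul_smul_comm, smul_smul, mul_inv_cancel₀ hε.ne', one_smul, ← mul_assoc, hw2, one_mul]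
  simp only [e1, e2] at hj2
  refine hj2.mono ?_
  rintro _ ⟨x, ⟨hx1, hx2⟩, rfl⟩
  refine ⟨?_, ?_⟩
  · change IsUnit (ε • ((w : Unitization ℂ A) * x))
    rw [Algebra.smul_def]
    exact (hunit _ hε.ne').mul (IsUnit.mul ⟨⟨_, _, hw2, hw1⟩, rfl⟩ hx1)
  · rw [mem_ball_iff_norm] at hx2 ⊢
    have : ε • ((w : Unitization ℂ A) * x) - v = ε • ((w : Unitization ℂ A) * (x - ε⁻¹ • p)) := by
      rw [mul_sub, smul_sub, e1]
    rw [this, norm_smul, hnw', Real.norm_of_nonneg hε.le]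
    nlinarith

theorem CoveringDimLE.exists_partition {X : Type*} [TopologicalSpace X] [CompactSpace X]
    [T2Space X] (hX : CoveringDimLE X 1) {E : Type*} [PseudoMetricSpace E] (f : C(X, E)) {δ : ℝ}
    (hδ : 0 < δ) :
    ∃ (n : ℕ) (ρ : Fin n → C(X, ℝ)) (c : Fin n → X),
      (∀ x, ∑ i, ρ i x = 1) ∧ (∀ i x, ρ i x ≠ 0 → dist (f x) (f (c i)) < δ) ∧
      ∀ x i j k, ρ i x ≠ 0 → ρ j x ≠ 0 → ρ k x ≠ 0 → i = j ∨ j = k ∨ i = k := by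
  classical
  obtain ⟨t, ht⟩ := isCompact_univ.elim_finite_subcover
    (fun y : X => f ⁻¹' Metric.ball (f y) δ) (fun y => Metric.isOpen_ball.preimage f.continuous)
    (fun x _ => Set.mem_iUnion.2 ⟨x, Metric.mem_ball_self hδ⟩)
  obtain ⟨𝒱, hVo, hVc, hVr, hVn⟩ := hX (t.image fun y : X => f ⁻¹' Metric.ball (f y) δ)
    (by
      intro U hU
      obtain ⟨y, -, rfl⟩ := Finset.mem_image.1 hU
      exact Metric.isOpen_ball.preimage f.continuous)
    (by
      refine Set.eq_univ_of_univ_subset (ht.trans ?_)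
      intro x hx
      simp only [Set.mem_iUnion] at hx
      obtain ⟨y, hy, hxy⟩ := hx
      exact ⟨_, by simpa using ⟨y, hy, rfl⟩, hxy⟩)
  let e := 𝒱.equivFin
  let V : Fin 𝒱.card → Set X := fun i => (e.symm i).1
  have hV : ∀ i, V i ∈ 𝒱 := fun i => (e.symm i).2
  have hVinj : Function.Injective V := fun i j h => e.symm.injective (Subtype.ext h)
  have hVcov : (Set.univ : Set X) ⊆ ⋃ i, V i := by
    intro x _
    obtain ⟨W, hW, hx⟩ := Set.mem_sUnion.1 (hVc ▸ Set.mem_univ x)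
    exact Set.mem_iUnion.2 ⟨e ⟨W, hW⟩, by simpa [V] using hx⟩
  obtain ⟨ρ, hρ⟩ := PartitionOfUnity.exists_isSubordinate isClosed_univ V (fun i => hVo _ (hV i))
    hVcov
  have hsub : ∀ i x, ρ i x ≠ 0 → x ∈ V i := fun i x h => hρ i (subset_tsupport _ h)
  have hc : ∀ i, ∃ y : X, V i ⊆ f ⁻¹' Metric.ball (f y) δ := by
    intro i
    obtain ⟨U, hU, h⟩ := hVr _ (hV i)
    obtain ⟨y, -, rfl⟩ := Finset.mem_image.1 hU
    exact ⟨y, h⟩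
  choose c hc using hc
  refine ⟨_, ρ, c, fun x => ?_, fun i x h => hc i (hsub i x h), ?_⟩
  · rw [← finsum_eq_sum_of_fintype]
    exact ρ.sum_eq_one (Set.mem_univ x)
  · intro x i j k hi hj hk
    by_contra! hne
    have hfin : {W : Set X | W ∈ 𝒱 ∧ x ∈ W}.Finite := 𝒱.finite_toSet.subset fun W hW => hW.1
    have hsubset : ({V i, V j, V k} : Set (Set X)) ⊆ {W : Set X | W ∈ 𝒱 ∧ x ∈ W} := by
      rintro W (rfl | rfl | rfl)
      · exact ⟨hV _, hsub _ _ hi⟩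
      · exact ⟨hV _, hsub _ _ hj⟩
      · exact ⟨hV _, hsub _ _ hk⟩
    have h3 := (Set.ncard_le_ncard hsubset hfin).trans (hVn x)
    rw [Set.ncard_eq_three.2 ⟨_, _, _, hVinj.ne hne.1, hVinj.ne hne.2.2, hVinj.ne hne.2.1, rfl⟩]
      at h3
    norm_num at h3

/-- On a space of covering dimension at most one, a continuous function can be approximated by
one with values in a dense set whose nearby points are joined by short paths. -/
theorem CoveringDimLE.exists_continuous_mem {X : Type*} [TopologicalSpace X] [CompactSpace X]
    [T2Space X] (hX : CoveringDimLE X 1) {E : Type*} [PseudoMetricSpace E] (f : C(X, E))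
    {U : Set E} (hU : Dense U) {δ M : ℝ} (hδ : 0 < δ)
    (hpath : ∀ a ∈ U, ∀ b ∈ U, (∃ x, dist a (f x) < δ) → dist a b < 4 * δ →
      JoinedIn (U ∩ Metric.ball a M) a b) :
    ∃ g : C(X, E), ∀ x, g x ∈ U ∧ dist (g x) (f x) < M + 2 * δ := by
  obtain ⟨n, ρ, c, hρ1, hρf, hρ3⟩ := hX.exists_partition f hδ
  have ha : ∀ i, ∃ a ∈ U, dist a (f (c i)) < δ := by
    intro i
    obtain ⟨a, haU, ha⟩ := Metric.mem_closure_iff.1 (hU (f (c i))) δ hδ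
    exact ⟨a, haU, by rwa [dist_comm]⟩
  choose a haU haf using ha
  have hax : ∀ i x, ρ i x ≠ 0 → dist (a i) (f x) < 2 * δ := by
    intro i x h
    have h1 := hρf i x h
    have h2 := haf i
    rw [dist_comm] at h1
    linarith [dist_triangle (a i) (f (c i)) (f x)]
  let P := {p : Fin n × Fin n // p.1 ≤ p.2 ∧ ∃ x, ρ p.1 x ≠ 0 ∧ ρ p.2 x ≠ 0}
  have hγ : ∀ p : P, JoinedIn (U ∩ Metric.ball (a p.1.1) M) (a p.1.1) (a p.1.2) := by
    rintro ⟨⟨i, j⟩, -, x, hi, hj⟩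
    refine hpath _ (haU i) _ (haU j) ⟨c i, haf i⟩ ?_
    have h1 := hax i x hi
    have h2 := hax j x hj
    rw [dist_comm] at h2
    linarith [dist_triangle (a i) (f x) (a j)]
  choose γ hγ using hγ
  let C : P → Set X := fun p => {x | ∀ k, k ≠ p.1.1 → k ≠ p.1.2 → ρ k x = 0}
  have hCcl : ∀ p, IsClosed (C p) := by
    intro p
    simp only [C, Set.ofPred_forall]
    exact isClosed_iInter fun k => isClosed_iInter fun _ => isClosed_iInter fun _ =>
      isClosed_eq (ρ k).continuous continuous_const
  have hne : ∀ x, ∃ i, ρ i x ≠ 0 := by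
    intro x
    by_contra! h
    have := hρ1 x
    simp [h] at this
  have hcov : ∀ x, ∃ p, x ∈ C p ∧ ρ p.1.1 x ≠ 0 := by
    intro x
    obtain ⟨i, hi⟩ := hne x
    by_cases h : ∃ j, j ≠ i ∧ ρ j x ≠ 0
    · obtain ⟨j, hji, hj⟩ := h
      have key : ∀ k, k ≠ i → k ≠ j → ρ k x = 0 := by
        intro k hk1 hk2
        by_contra hk
        rcases hρ3 x k i j hk hi hj with h | h | h
        · exact hk1 h
        · exact hji h.symm
        · exact hk2 h
      rcases le_total i j with hij | hij
      · exact ⟨⟨(i, j), hij, x, hi, hj⟩, key, hi⟩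
      · exact ⟨⟨(j, i), hij, x, hj, hi⟩, fun k h1 h2 => key k h2 h1, hj⟩
    · push Not at h
      exact ⟨⟨(i, i), le_rfl, x, hi, hi⟩, fun k h1 _ => h k h1, hi⟩
  let G : P → X → E := fun p x => (γ p).extend (ρ p.1.2 x)
  have hGc : ∀ p, Continuous (G p) := fun p => (γ p).continuous_extend.comp (ρ p.1.2).continuous
  have hsingle : ∀ p x s, x ∈ C p → (∀ k, k ≠ s → ρ k x = 0) → G p x = a s := by
    intro p x s hp hs
    have hs1 : ρ s x = 1 := by
      rw [← hρ1 x, Finset.sum_eq_single s (fun k _ hk => hs k hk) (by simp)]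
    by_cases h2 : s = p.1.2
    · rw [h2] at hs1
      simp only [G]
      rw [hs1, Path.extend_one]
      exact congrArg a h2.symm
    · have h1 : s = p.1.1 := by
        by_contra h1
        rw [hp s h1 h2] at hs1
        exact zero_ne_one hs1
      simp only [G]
      rw [hs _ (Ne.symm h2), Path.extend_zero, h1]
  have hcons : ∀ p q x, x ∈ C p → x ∈ C q → ρ p.1.1 x ≠ 0 → G q x = G p x := by
    intro p q x hp hq hi
    by_cases h : ∃ j, j ≠ p.1.1 ∧ ρ j x ≠ 0
    · obtain ⟨j, hji, hj⟩ := h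
      have hj2 : j = p.1.2 := by
        by_contra h2
        exact hj (hp j hji h2)
      have e1 : p.1.1 = q.1.1 ∨ p.1.1 = q.1.2 := by
        by_contra! h
        exact hi (hq _ h.1 h.2)
      have e2 : p.1.2 = q.1.1 ∨ p.1.2 = q.1.2 := by
        by_contra! h
        exact hj (hj2 ▸ hq _ h.1 h.2)
      have hlt : p.1.1 < p.1.2 := lt_of_le_of_ne p.2.1 (hj2 ▸ hji.symm)
      have hq1 := q.2.1
      have : q = p := by
        refine Subtype.ext (Prod.ext ?_ ?_) <;> omega
      rw [this]
    · push Not at h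
      rw [hsingle p x _ hp h, hsingle q x _ hq h]
  choose p hpC hp0 using hcov
  let g : X → E := fun x => G (p x) x
  have hg : Continuous g := by
    refine (locallyFinite_of_finite C).continuous ?_ hCcl fun q => ?_
    · exact Set.eq_univ_of_forall fun x => Set.mem_iUnion.2 ⟨p x, hpC x⟩
    · exact (hGc q).continuousOn.congr fun x hx => (hcons (p x) q x (hpC x) hx (hp0 x)).symm
  refine ⟨⟨g, hg⟩, fun x => ?_⟩
  have hmem : g x ∈ U ∩ Metric.ball (a (p x).1.1) M := by
    have : g x ∈ Set.range (γ (p x)) := by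
      rw [← Path.extend_range]; exact ⟨_, rfl⟩
    obtain ⟨t, ht⟩ := this
    rw [← ht]
    exact hγ _ t
  refine ⟨hmem.1, ?_⟩
  have h1 := hax _ x (hp0 x)
  have h2 := hmem.2
  rw [Metric.mem_ball] at h2
  change dist (g x) (f x) < _
  linarith [dist_triangle (g x) (a (p x).1.1) (f x)]

theorem Unitization.norm_fst_le {A : Type*} [NonUnitalCStarAlgebra A] (a : Unitization ℂ A) :
    ‖a.fst‖ ≤ ‖a‖ := by
  let φ : Unitization ℂ A →⋆ₐ[ℂ] ℂ :=
    { Unitization.fstHom ℂ A with map_star' := fun a => by simp }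
  exact NonUnitalStarAlgHom.norm_apply_le φ a

/-- An element of the unitization of `C(X, A)` with nonzero scalar part is invertible as soon as
all its values are. -/
theorem ContinuousMap.isUnit_unitization {A : Type*} [NonUnitalCStarAlgebra A] {X : Type*}
    [TopologicalSpace X] [CompactSpace X] {z : Unitization ℂ C(X, A)} (hz : z.fst ≠ 0)
    (h : ∀ x, IsUnit (Unitization.inl z.fst + ((z.snd x : A) : Unitization ℂ A) : Unitization ℂ A)) : IsUnit z := by
  let v : X → Unitization ℂ A := fun x => Unitization.inl z.fst + ((z.snd x : A) : Unitization ℂ A)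
  have hv : Continuous v := by
    refine continuous_const.add ?_
    exact (Unitization.isometry_inr (𝕜 := ℂ) (A := A)).continuous.comp z.snd.continuous
  have hvi : Continuous fun x => Ring.inverse (v x) := by
    refine continuous_iff_continuousAt.2 fun x => ?_
    obtain ⟨u, hu⟩ := h x
    have := NormedRing.inverse_continuousAt u
    rw [hu] at this
    exact ContinuousAt.comp (f := v) (x := x) this hv.continuousAt
  let m : C(X, A) := ⟨fun x => (Ring.inverse (v x)).snd, Unitization.continuous_snd.comp hvi⟩
  have hvf : ∀ x, (v x).fst = z.fst := fun x => by simp [v]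
  have hvs : ∀ x, (v x).snd = z.snd x := fun x => by simp [v]
  have h1 : ∀ x, v x * Ring.inverse (v x) = 1 := fun x => Ring.mul_inverse_cancel _ (h x)
  have h2 : ∀ x, Ring.inverse (v x) * v x = 1 := fun x => Ring.inverse_mul_cancel _ (h x)
  have hf : ∀ x, (Ring.inverse (v x)).fst = z.fst⁻¹ := fun x => by
    have := congrArg (fun z => z.fst) (h1 x)
    simp only [Unitization.fst_mul, hvf, Unitization.fst_one] at this
    exact eq_inv_of_mul_eq_one_right this
  refine ⟨⟨z, Unitization.inl z.fst⁻¹ + (m : Unitization ℂ C(X, A)), ?_, ?_⟩, rfl⟩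
  · refine Unitization.ext ?_ ?_
    · simp [hz]
    · ext x
      have := congrArg (fun z => z.snd) (h1 x)
      simp only [Unitization.snd_mul, hvf, hvs, hf, Unitization.snd_one] at this
      simpa [m] using this
  · refine Unitization.ext ?_ ?_
    · simp [hz]
    · ext x
      have := congrArg (fun z => z.snd) (h2 x)
      simp only [Unitization.snd_mul, hvf, hvs, hf, Unitization.snd_one] at this
      simpa [m] using this

theorem NoK1Obstructions.exists_isUnit_near {A : Type*} [NonUnitalCStarAlgebra A]
    (hA : NoK1Obstructions A) {X : Type*} [TopologicalSpace X] [CompactSpace X] [T2Space X]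
    (hX : CoveringDimLE X 1) {z : Unitization ℂ C(X, A)} (hz : z.fst ≠ 0) {ε : ℝ} (hε : 0 < ε) :
    ∃ z' : Unitization ℂ C(X, A), IsUnit z' ∧ ‖z' - z‖ < ε := by
  let f : C(X, Unitization ℂ A) := ⟨fun x => Unitization.inl z.fst + ((z.snd x : A) : Unitization ℂ A),
    continuous_const.add
      ((Unitization.isometry_inr (𝕜 := ℂ) (A := A)).continuous.comp z.snd.continuous)⟩
  have hff : ∀ x, (f x).fst = z.fst := fun x => by simp [f]
  have hfs : ∀ x, (f x).snd = z.snd x := fun x => by simp [f]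
  have hl : 0 < ‖z.fst‖ := norm_pos_iff.2 hz
  obtain ⟨δ, hδ, hδ1, hδ2, hδ3⟩ : ∃ δ : ℝ, 0 < δ ∧ 3204 * δ < ‖z.fst‖ ∧ 1602 * δ < 1 ∧
      1602 * δ * 2 / ‖z.fst‖ * (‖f‖ + 1) + 1602 * δ < ε := by
    have h0 : ∀ c : ℝ → ℝ, Continuous c → c 0 = 0 → ∀ r > 0, ∀ᶠ δ in 𝓝[>] (0 : ℝ), c δ < r := by
      intro c hc hc0 r hr
      refine (hc.continuousAt.tendsto.mono_left nhdsWithin_le_nhds).eventually_lt_const ?_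
      rwa [hc0]
    exact ((eventually_mem_nhdsWithin (a := (0 : ℝ)) (s := Set.Ioi 0)).and
      ((h0 (fun δ => 3204 * δ) (by fun_prop) (by simp) _ hl).and
      ((h0 (fun δ => 1602 * δ) (by fun_prop) (by simp) _ one_pos).and
      (h0 (fun δ => 1602 * δ * 2 / ‖z.fst‖ * (‖f‖ + 1) + 1602 * δ) (by fun_prop) (by simp)
        _ hε)))).exists
  obtain ⟨g, hg⟩ := hX.exists_continuous_mem f (U := {x | IsUnit x}) hA.1 (M := 400 * (4 * δ)) hδ
    (by
      rintro a ha b hb ⟨x, hx⟩ hab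
      refine hA.joinedIn_ball ha hb (by positivity) (by rwa [← dist_eq_norm]) ?_
      have h1 := Unitization.norm_fst_le (f x - a)
      rw [dist_comm, dist_eq_norm] at hx
      have h2 : (f x - a).fst = z.fst - a.fst := by simp [sub_eq_add_neg, f]
      rw [h2] at h1
      linarith [norm_sub_norm_le z.fst a.fst])
  have hgf : ∀ x, ‖g x - f x‖ < 1602 * δ := fun x => by
    have := (hg x).2
    rw [dist_eq_norm] at this
    linarith
  have hμ : ∀ x, ‖z.fst - (g x).fst‖ < 1602 * δ := fun x => by
    have h1 := Unitization.norm_fst_le (g x - f x)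
    have h2 : (g x - f x).fst = (g x).fst - z.fst := by simp [sub_eq_add_neg, f]
    rw [h2, norm_sub_rev] at h1
    exact h1.trans_lt (hgf x)
  have hμ' : ∀ x, ‖z.fst‖ / 2 ≤ ‖(g x).fst‖ := fun x => by
    linarith [norm_sub_norm_le z.fst (g x).fst, hμ x]
  have hμ0 : ∀ x, (g x).fst ≠ 0 := fun x => norm_pos_iff.1 (by linarith [hμ' x])
  let k : X → Unitization ℂ A := fun x => (z.fst / (g x).fst) • g x
  have hk : Continuous k :=
    (continuous_const.div (Unitization.continuous_fst.comp g.continuous) hμ0).smul g.continuous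
  have hkf : ∀ x, (k x).fst = z.fst := fun x => by
    simp [k, hμ0 x]
  have hkn : ∀ x, ‖k x - f x‖ ≤ 1602 * δ * 2 / ‖z.fst‖ * (‖f‖ + 1) + 1602 * δ := fun x => by
    have e : k x - f x = ((z.fst - (g x).fst) / (g x).fst) • g x + (g x - f x) := by
      rw [sub_div, div_self (hμ0 x), sub_smul, one_smul]
      simp [k]
    have h1 : ‖g x‖ ≤ ‖f‖ + 1 := by
      have := norm_le_norm_add_norm_sub' (g x) (f x)
      linarith [f.norm_coe_le_norm x, hgf x]
    rw [e]
    refine (norm_add_le _ _).trans (add_le_add ?_ (hgf x).le)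
    rw [norm_smul, norm_div]
    refine mul_le_mul ?_ h1 (norm_nonneg _) (by positivity)
    rw [mul_div_assoc, div_eq_mul_inv, ← inv_div]
    exact mul_le_mul (hμ x).le (inv_anti₀ (by positivity) (hμ' x)) (by positivity) (by positivity)
  let ks : C(X, A) := ⟨fun x => (k x).snd, Unitization.continuous_snd.comp hk⟩
  have hz' : ∀ x, (Unitization.inl z.fst + ((ks x : A) : Unitization ℂ A)) = k x := fun x => by
    refine Unitization.ext ?_ ?_ <;> simp [ks, hkf]
  refine ⟨Unitization.inl z.fst + (ks : Unitization ℂ C(X, A)), ?_, ?_⟩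
  · refine ContinuousMap.isUnit_unitization (by simpa using hz) fun x => ?_
    have e : (Unitization.inl (Unitization.inl z.fst + (ks : Unitization ℂ C(X, A))).fst +
        (((Unitization.inl z.fst + (ks : Unitization ℂ C(X, A))).snd x : A) : Unitization ℂ A)) =
        (z.fst / (g x).fst) • g x := by
      simp only [Unitization.fst_add, Unitization.snd_add, Unitization.fst_inl,
        Unitization.snd_inl, Unitization.fst_inr, Unitization.snd_inr, add_zero, zero_add]
      exact hz' x
    rw [e]
    have := (hg x).1.smul (Units.mk0 (z.fst / (g x).fst) (div_ne_zero hz (hμ0 x)))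
    exact this
  · have e : Unitization.inl z.fst + (ks : Unitization ℂ C(X, A)) - z =
        ((ks - z.snd : C(X, A)) : Unitization ℂ C(X, A)) := by
      refine Unitization.ext ?_ ?_ <;> simp [sub_eq_add_neg]
    rw [e, Unitization.norm_inr, ContinuousMap.norm_lt_iff _ hε]
    intro x
    have e2 : (((ks - z.snd) x : A) : Unitization ℂ A) = k x - f x := by
      refine Unitization.ext ?_ ?_ <;> simp [sub_eq_add_neg, ks, f, hkf]
    rw [← Unitization.norm_inr (𝕜 := ℂ), e2]
    exact (hkn x).trans_lt hδ3

theorem NoK1Obstructions.stableRankOne_continuousMap {A : Type*} [NonUnitalCStarAlgebra A]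
    (hA : NoK1Obstructions A) {X : Type*} [TopologicalSpace X] [CompactSpace X] [T2Space X]
    (hX : CoveringDimLE X 1) : StableRankOne C(X, A) := by
  refine Metric.dense_iff.2 fun z ε hε => ?_
  obtain ⟨c, hc0, hc⟩ : ∃ c : ℂ, c ≠ 0 ∧ ‖c - z.fst‖ < ε / 2 := by
    have : (Metric.ball z.fst (ε / 2) ∩ {0}ᶜ).Nonempty :=
      (dense_compl_singleton (0 : ℂ)).inter_open_nonempty _ Metric.isOpen_ball
        ⟨_, Metric.mem_ball_self (half_pos hε)⟩
    obtain ⟨c, h1, h2⟩ := this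
    exact ⟨c, h2, by rwa [Metric.mem_ball, dist_eq_norm] at h1⟩
  obtain ⟨z', hz', h⟩ := hA.exists_isUnit_near hX
    (z := Unitization.inl c + (z.snd : Unitization ℂ C(X, A))) (by simpa using hc0) (half_pos hε)
  refine ⟨z', ?_, hz'⟩
  rw [Metric.mem_ball, dist_eq_norm]
  have e : z' - z = (z' - (Unitization.inl c + (z.snd : Unitization ℂ C(X, A)))) +
      algebraMap ℂ (Unitization ℂ C(X, A)) (c - z.fst) := by
    rw [Unitization.algebraMap_eq_inl]
    refine Unitization.ext ?_ ?_ <;> simp [sub_eq_add_neg]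
  rw [e]
  refine (norm_add_le _ _).trans_lt ?_
  rw [norm_algebraMap']
  linarith

theorem StableRankOne.realRankLE_one {A : Type*} [NonUnitalCStarAlgebra A]
    (hA : StableRankOne A) : RealRankLE A 1 := by
  intro a ha ε hε
  let z : Unitization ℂ A := a 0 + Complex.I • a 1
  obtain ⟨w, hw, hwu⟩ := Metric.dense_iff.1 hA z ε hε
  rw [Metric.mem_ball, dist_eq_norm] at hw
  have hr : ∀ b : Unitization ℂ A, ‖(realPart b : Unitization ℂ A)‖ ≤ ‖b‖ := realPart.norm_le
  have hi : ∀ b : Unitization ℂ A, ‖(imaginaryPart b : Unitization ℂ A)‖ ≤ ‖b‖ :=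
    imaginaryPart.norm_le
  have hzr : (realPart z : Unitization ℂ A) = a 0 := by
    simp [z, realPart_I_smul, (ha 0).coe_realPart, (ha 1).imaginaryPart]
  have hzi : (imaginaryPart z : Unitization ℂ A) = a 1 := by
    simp [z, imaginaryPart_I_smul, (ha 1).coe_realPart, (ha 0).imaginaryPart]
  refine ⟨![realPart w, imaginaryPart w], ?_, ?_, ?_⟩
  · intro k
    fin_cases k
    · exact (realPart w).2
    · exact (imaginaryPart w).2
  · let _ := CStarAlgebra.spectralOrder (Unitization ℂ A)
    let _ := CStarAlgebra.spectralOrderedRing (Unitization ℂ A)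
    have h1 : IsStrictlyPositive (star w * w) :=
      IsUnit.isStrictlyPositive (hwu.star.mul hwu) (star_mul_self_nonneg w)
    have h2 : IsUnit (star w * w + w * star w) := (h1.add_nonneg (mul_star_self_nonneg w)).isUnit
    have e : ∑ k, (![(realPart w : Unitization ℂ A), imaginaryPart w] k) ^ 2 =
        (1 / 2 : ℂ) • (star w * w + w * star w) := by
      have h3 := realPart_add_I_smul_imaginaryPart w
      have hr2 : star (realPart w : Unitization ℂ A) = realPart w := (realPart w).2
      have hi2 : star (imaginaryPart w : Unitization ℂ A) = imaginaryPart w := (imaginaryPart w).2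
      generalize (realPart w : Unitization ℂ A) = r at *
      generalize (imaginaryPart w : Unitization ℂ A) = s at *
      subst h3
      simp only [Fin.sum_univ_two, Matrix.cons_val_zero, Matrix.cons_val_one, star_add, star_smul,
        hr2, hi2, Complex.star_def, Complex.conj_I, add_mul, mul_add, smul_mul_assoc,
        mul_smul_comm, mul_neg, pow_two]
      match_scalars <;> ring_nf <;> simp
    rw [e]
    exact h2.smul (Units.mk0 (1 / 2 : ℂ) (by norm_num))
  · intro k
    fin_cases k
    · have : ‖(realPart (w - z) : Unitization ℂ A)‖ < ε := (hr _).trans_lt hw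
      simpa [hzr] using this
    · have : ‖(imaginaryPart (w - z) : Unitization ℂ A)‖ < ε := (hi _).trans_lt hw
      simpa [hzi] using this

theorem CoveringDimLE.zero_of_totallyDisconnected (X : Type*) [TopologicalSpace X] [CompactSpace X]
    [T2Space X] [TotallyDisconnectedSpace X] : CoveringDimLE X 0 := by
  classical
  intro 𝒰 hUo hUc
  have hU : TopologicalSpace.IsOpenCover
      fun U : 𝒰 => (⟨U.1, hUo U.1 U.2⟩ : TopologicalSpace.Opens X) := by
    refine .of_sets _ ?_
    rw [← hUc, Set.sUnion_eq_iUnion]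
    rfl
  obtain ⟨n, W, hW, hWc, hWd⟩ := hU.exists_finite_nonempty_disjoint_clopen_cover
  refine ⟨Finset.univ.image fun j => (W j : Set X), ?_, ?_, ?_, ?_⟩
  · intro V hV
    obtain ⟨j, -, rfl⟩ := Finset.mem_image.1 hV
    exact (W j).isClopen.2
  · refine Set.eq_univ_of_forall fun x => ?_
    obtain ⟨j, hj⟩ := Set.mem_iUnion.1 (hWc (Set.mem_univ x))
    exact ⟨W j, by simp, hj⟩
  · intro V hV
    obtain ⟨j, -, rfl⟩ := Finset.mem_image.1 hV
    obtain ⟨⟨U, hU⟩, h⟩ := (hW j).2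
    exact ⟨U, hU, h⟩
  · intro x
    refine (Set.ncard_le_one_iff ((Finset.finite_toSet _).subset fun V hV => hV.1)).2 ?_
    rintro V V' ⟨hV, hx⟩ ⟨hV', hx'⟩
    obtain ⟨i, -, rfl⟩ := Finset.mem_image.1 hV
    obtain ⟨j, -, rfl⟩ := Finset.mem_image.1 hV'
    by_contra hij
    have h := hWd (fun h : i = j => hij (by rw [h]))
    have h2 : x ∈ W i ⊓ W j := ⟨hx, hx'⟩
    rw [h.eq_bot] at h2
    exact h2

theorem IsStrictlyPositive.exists_algebraMap_le {A : Type*} [CStarAlgebra A] [PartialOrder A]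
    [StarOrderedRing A] [Nontrivial A] {a : A} (ha : IsStrictlyPositive a) :
    ∃ r > 0, algebraMap ℝ A r ≤ a :=
  (CFC.exists_pos_algebraMap_le_iff ha.isSelfAdjoint).2 fun _ hx => ha.spectrum_pos hx

theorem isClopen_setOf_nonneg_of_isUnit {A : Type*} [CStarAlgebra A] [PartialOrder A]
    [StarOrderedRing A] {X : Type*} [TopologicalSpace X] {v : X → A} (hv : Continuous v)
    (hs : ∀ x, IsSelfAdjoint (v x)) (hu : ∀ x, IsUnit (v x)) : IsClopen {x | 0 ≤ v x} := by
  rcases subsingleton_or_nontrivial A with hA | hA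
  · convert isClopen_univ (X := X)
    exact Set.eq_univ_of_forall fun x => (Subsingleton.elim _ _).le
  refine ⟨isClosed_le continuous_const hv, isOpen_iff_mem_nhds.2 fun x hx => ?_⟩
  obtain ⟨r, hr, h⟩ := ((hu x).isStrictlyPositive hx).exists_algebraMap_le
  have h1 : ∀ᶠ y in 𝓝 x, ‖v y - v x‖ < r := by
    refine ((hv.sub continuous_const).norm.continuousAt (x := x)).eventually_lt_const ?_
    simpa using hr
  filter_upwards [h1] with y hy
  have h2 := ((hs y).sub (hs x)).neg_algebraMap_norm_le_self
  have h3 : algebraMap ℝ A ‖v y - v x‖ ≤ algebraMap ℝ A r := algebraMap_mono A hy.le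
  calc (0 : A) ≤ algebraMap ℝ A r - algebraMap ℝ A ‖v y - v x‖ := sub_nonneg.2 h3
    _ ≤ v x + (v y - v x) := by rw [sub_eq_add_neg]; exact add_le_add h h2
    _ = v y := by abel

/-- Evaluation at a point, extended to unitizations. -/
def ContinuousMap.unitizationEval {X : Type*} [TopologicalSpace X] [CompactSpace X]
    (A : Type*) [NonUnitalCStarAlgebra A] (x : X) :
    Unitization ℂ C(X, A) →⋆ₐ[ℂ] Unitization ℂ A :=
  Unitization.starMap
    { toFun := fun f => f x
      map_smul' := fun _ _ => rfl
      map_zero' := rfl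
      map_add' := fun _ _ => rfl
      map_mul' := fun _ _ => rfl
      map_star' := fun _ => rfl }

theorem ContinuousMap.continuous_unitizationEval {X : Type*} [TopologicalSpace X] [CompactSpace X]
    {A : Type*} [NonUnitalCStarAlgebra A] (z : Unitization ℂ C(X, A)) :
    Continuous fun x => unitizationEval A x z := by
  have e : (fun x => unitizationEval A x z) =
      fun x => Unitization.inl z.fst + ((z.snd x : A) : Unitization ℂ A) := by
    funext x
    refine Unitization.ext ?_ ?_
    · simp [unitizationEval, Unitization.algebraMap_eq_inl]
    · simp [unitizationEval, Unitization.algebraMap_eq_inl]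
      rfl
  rw [e]
  exact continuous_const.add
    ((Unitization.isometry_inr (𝕜 := ℂ) (A := A)).continuous.comp z.snd.continuous)

theorem ContinuousMap.unitizationEval_inr {X : Type*} [TopologicalSpace X] [CompactSpace X]
    {A : Type*} [NonUnitalCStarAlgebra A] (f : C(X, A)) (x : X) :
    unitizationEval A x (f : Unitization ℂ C(X, A)) = ((f x : A) : Unitization ℂ A) := by
  refine Unitization.ext ?_ ?_
  · simp [unitizationEval]
  · simp [unitizationEval]
    rfl

theorem exists_norm_star_mul_self_eq_one (A : Type*) [NonUnitalCStarAlgebra A] [Nontrivial A] :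
    ∃ a : A, ‖star a * a‖ = 1 := by
  obtain ⟨a, ha⟩ := exists_ne (0 : A)
  have := norm_pos_iff.2 ha
  refine ⟨((‖a‖⁻¹ : ℝ) : ℂ) • a, ?_⟩
  rw [CStarRing.norm_star_mul_self, norm_smul]
  simp [this.ne']

theorem RealRankLE.totallyDisconnectedSpace {A : Type*} [NonUnitalCStarAlgebra A] [Nontrivial A]
    {X : Type*} [MetricSpace X] [CompactSpace X] (h : RealRankLE C(X, A) 0) :
    TotallyDisconnectedSpace X := by
  let _ := CStarAlgebra.spectralOrder (Unitization ℂ A)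
  let _ := CStarAlgebra.spectralOrderedRing (Unitization ℂ A)
  refine totallyDisconnectedSpace_iff_connectedComponent_subsingleton.2 fun x₀ => ?_
  suffices hx : ∀ y ∈ connectedComponent x₀, y = x₀ from
    fun y hy z hz => (hx y hy).trans (hx z hz).symm
  intro y₀ hy
  by_contra hne
  have hd : 0 < dist y₀ x₀ := dist_pos.2 hne
  obtain ⟨a, ha⟩ := exists_norm_star_mul_self_eq_one A
  let F : C(X, A) := ⟨fun x => ((dist x x₀ / dist y₀ x₀ : ℝ) : ℂ) • (star a * a), by fun_prop⟩
  let b : Unitization ℂ C(X, A) := algebraMap ℂ _ (1 / 2) - (F : Unitization ℂ C(X, A))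
  have hb : IsSelfAdjoint b := by
    refine IsSelfAdjoint.sub ?_ ?_
    · rw [isSelfAdjoint_iff, ← algebraMap_star_comm]
      simp
    · have hF : star F = F := by
        ext x
        simp [F]
      rw [isSelfAdjoint_iff, ← Unitization.inr_star, hF]
  obtain ⟨c, hc, hcu, hcb⟩ := h (fun _ => b) (fun _ => hb) (1 / 4) (by norm_num)
  rw [Fin.sum_univ_one, isUnit_pow_iff two_ne_zero] at hcu
  let v : X → Unitization ℂ A := fun x => ContinuousMap.unitizationEval A x (c 0)
  have hvs : ∀ x, IsSelfAdjoint (v x) := fun x => (hc 0).map _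
  have hvu : ∀ x, IsUnit (v x) := fun x => hcu.map _
  have hcl := isClopen_setOf_nonneg_of_isUnit (ContinuousMap.continuous_unitizationEval (c 0))
    hvs hvu
  have hbx : ∀ x, ContinuousMap.unitizationEval A x b =
      algebraMap ℝ _ (1 / 2) - ((F x : A) : Unitization ℂ A) := by
    intro x
    simp only [b, map_sub, AlgHomClass.commutes]
    congr 1
    · rw [IsScalarTower.algebraMap_apply ℝ ℂ]
      simp
    · exact ContinuousMap.unitizationEval_inr F x
  have hdist : ∀ x, ‖v x - (algebraMap ℝ _ (1 / 2) - ((F x : A) : Unitization ℂ A))‖ ≤ 1 / 4 := by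
    intro x
    rw [← hbx, ← map_sub]
    exact (NonUnitalStarAlgHom.norm_apply_le _ _).trans (hcb 0).le
  have hsa : ∀ x, IsSelfAdjoint
      (v x - (algebraMap ℝ _ (1 / 2) - ((F x : A) : Unitization ℂ A))) := by
    intro x
    rw [← hbx]
    exact (hvs x).sub (hb.map _)
  have hx₀ : x₀ ∈ {x | 0 ≤ v x} := by
    have h1 := (hsa x₀).neg_algebraMap_norm_le_self
    have h2 : algebraMap ℝ (Unitization ℂ A) _ ≤ algebraMap ℝ (Unitization ℂ A) _ :=
      algebraMap_mono _ (hdist x₀)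
    have hF : F x₀ = 0 := by simp [F]
    rw [hF] at h1 h2
    simp only [Unitization.inr_zero, sub_zero] at h1 h2
    have h3 := (neg_le_neg h2).trans h1
    have h4 : algebraMap ℝ (Unitization ℂ A) (1 / 4) ≤ algebraMap ℝ _ (1 / 2) :=
      algebraMap_mono _ (by norm_num)
    rw [neg_le_sub_iff_le_add] at h3
    exact nonneg_of_le_add_left (h4.trans h3)
  have hy₀ : 0 ≤ v y₀ :=
    isPreconnected_connectedComponent.subset_isClopen hcl ⟨x₀, mem_connectedComponent, hx₀⟩ hy
  have h1 := (hsa y₀).le_algebraMap_norm_self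
  have h2 : algebraMap ℝ (Unitization ℂ A) _ ≤ algebraMap ℝ (Unitization ℂ A) _ :=
    algebraMap_mono _ (hdist y₀)
  have hF : F y₀ = star a * a := by simp [F, hd.ne']
  rw [hF] at h1 h2
  have h3 : ((star a * a : A) : Unitization ℂ A) ≤ algebraMap ℝ _ (3 / 4) := by
    have h4 := h1.trans h2
    have h5 : (3 / 4 : ℝ) = 1 / 4 + 1 / 2 := by norm_num
    rw [h5, map_add]
    calc ((star a * a : A) : Unitization ℂ A)
        ≤ v y₀ + ((star a * a : A) : Unitization ℂ A) := le_add_of_nonneg_left hy₀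
      _ = v y₀ - (algebraMap ℝ _ (1 / 2) - ((star a * a : A) : Unitization ℂ A)) +
          algebraMap ℝ _ (1 / 2) := by abel
      _ ≤ _ := by gcongr
  have h4 : (0 : Unitization ℂ A) ≤ ((star a * a : A) : Unitization ℂ A) := by
    rw [Unitization.inr_mul, Unitization.inr_star]
    exact star_mul_self_nonneg _
  have h5 := (CStarAlgebra.norm_le_iff_le_algebraMap _ (by norm_num) h4).2 h3
  rw [Unitization.norm_inr, ha] at h5
  norm_num at h5

end

theorem stmt7 (A : Type*) [NonUnitalCStarAlgebra A] [Nontrivial A]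
    (hA : NoK1Obstructions A) (X : Type*) [MetricSpace X] [CompactSpace X]
    (hX : CoveringDimEq X 1) :
    RealRankLE C(X, A) 1 ∧ ¬ RealRankLE C(X, A) 0 := by
  refine ⟨(hA.stableRankOne_continuousMap hX.1).realRankLE_one, fun h => ?_⟩
  have := h.totallyDisconnectedSpace
  exact absurd (hX.2 0 (CoveringDimLE.zero_of_totallyDisconnected X)) (by norm_num)
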